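/- arXiv:funct-an/9609003 — 3 statements merged into one kernel-verified Lean document; each statement's English description precedes it below -/
import Mathlib

section
/- Let A be a C*-algebra with the extension property, and let M be an A-reflexive Hilbert A-module. Then M is orthogonally complementary (for every Hilbert A-module L and every injective bounded A-linear map ι : M → L with norm-closed range and bounded inverse on its range, L decomposes as the orthogonal direct sum L = ι(M) ⊕ ι(M)^⊥), and every bounded A-linear operator T : M → M possesses an adjoint bounded A-linear operator T* : M → M with ⟨Tx, y⟩ = ⟨x, T*y⟩ for all x, y ∈ M. -/
noncomputable section

open scoped ENNReal MultiplierAlgebra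

universe u v w

/-- A (left) Hilbert C*-module over a (not necessarily unital) C*-algebra `A`:
a Banach space `M` which is a (nonunital) left `A`-module equipped with an `A`-valued
inner product, `A`-linear in the first variable, satisfying `⟨x,y⟩ = ⟨y,x⟩*`,
`⟨x,x⟩ ≥ 0` (i.e. of the form `b* b`), definiteness, and such that the norm of `M`
satisfies `‖x‖ = ‖⟨x,x⟩‖ ^ (1/2)` and `M` is complete. -/
class HilbertCStarModule (A : Type u) (M : Type v) [NonUnitalCStarAlgebra A]
    [NormedAddCommGroup M] [NormedSpace ℂ M] [SMul A M] where
  inner : M → M → A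
  smul_add' : ∀ (a : A) (x y : M), a • (x + y) = a • x + a • y
  add_smul' : ∀ (a b : A) (x : M), (a + b) • x = a • x + b • x
  mul_smul' : ∀ (a b : A) (x : M), (a * b) • x = a • (b • x)
  smul_smul' : ∀ (c : ℂ) (a : A) (x : M), (c • a) • x = c • (a • x)
  inner_add_left : ∀ x y z : M, inner (x + y) z = inner x z + inner y z
  inner_smulA_left : ∀ (a : A) (x y : M), inner (a • x) y = a * inner x y
  inner_smulC_left : ∀ (c : ℂ) (x y : M), inner (c • x) y = c • inner x y
  inner_conj : ∀ x y : M, inner x y = star (inner y x)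
  inner_self_pos : ∀ x : M, ∃ b : A, inner x x = star b * b
  inner_self_eq_zero : ∀ x : M, inner x x = 0 ↔ x = 0
  norm_eq : ∀ x : M, ‖x‖ = Real.sqrt ‖inner x x‖
  complete : CompleteSpace M

section Defs

variable (A : Type u) [NonUnitalCStarAlgebra A] {M : Type v}
  [NormedAddCommGroup M] [NormedSpace ℂ M] [SMul A M]

/-- The `A`-valued inner product of a Hilbert C*-module. -/
def hInner [HilbertCStarModule A M] (x y : M) : A := HilbertCStarModule.inner x y

/-- The orthogonal complement `S^⊥ = {x | ⟨x, s⟩ = 0 for all s ∈ S}` of a subset `S`. -/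
def orthComp [HilbertCStarModule A M] (S : Set M) : Set M :=
  {x : M | ∀ s ∈ S, hInner A x s = 0}

/-- A Hilbert C*-submodule: a norm-closed subset which is closed under addition and under
the actions of `ℂ` and `A`. -/
structure IsHilbertSubmodule (N : Set M) : Prop where
  isClosed : IsClosed N
  zero_mem : (0 : M) ∈ N
  add_mem : ∀ ⦃x y : M⦄, x ∈ N → y ∈ N → x + y ∈ N
  smulC_mem : ∀ (c : ℂ) ⦃x : M⦄, x ∈ N → c • x ∈ N
  smulA_mem : ∀ (a : A) ⦃x : M⦄, x ∈ N → a • x ∈ N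

end Defs

section Maps

variable (A : Type u) [NonUnitalCStarAlgebra A] {M : Type v} {M₂ : Type w}
  [NormedAddCommGroup M] [NormedSpace ℂ M] [SMul A M]
  [NormedAddCommGroup M₂] [NormedSpace ℂ M₂] [SMul A M₂]

/-- A bounded `A`-linear map between (left) normed `A`-modules. -/
structure IsBoundedModuleMap (T : M → M₂) : Prop where
  map_add : ∀ x y : M, T (x + y) = T x + T y
  map_smulC : ∀ (c : ℂ) (x : M), T (c • x) = c • T x
  map_smulA : ∀ (a : A) (x : M), T (a • x) = a • T x
  bound : ∃ C : ℝ, ∀ x : M, ‖T x‖ ≤ C * ‖x‖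

/-- The operator norm of a map between normed modules. -/
def opNorm (T : M → M₂) : ℝ :=
  sInf {c : ℝ | 0 ≤ c ∧ ∀ x : M, ‖T x‖ ≤ c * ‖x‖}

end Maps

section Dual

variable (A : Type u) [NonUnitalCStarAlgebra A] {M : Type v}
  [NormedAddCommGroup M] [NormedSpace ℂ M] [SMul A M]

/-- A bounded `A`-linear map `M → A`, i.e. an element of the `A`-dual `M'`. -/
structure IsDualVector (r : M → A) : Prop where
  map_add : ∀ x y : M, r (x + y) = r x + r y
  map_smulC : ∀ (c : ℂ) (x : M), r (c • x) = c • r x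
  map_smulA : ∀ (a : A) (x : M), r (a • x) = a * r x
  bound : ∃ C : ℝ, ∀ x : M, ‖r x‖ ≤ C * ‖x‖

/-- The norm of an element of the `A`-dual. -/
def dualNorm (r : M → A) : ℝ :=
  sInf {c : ℝ | 0 ≤ c ∧ ∀ x : M, ‖r x‖ ≤ c * ‖x‖}

/-- A function `r : M → A` which restricts to a bounded `A`-linear map on the subset `S`;
this represents an element of the `A`-dual `S'` of the submodule `S` (only the values on `S`
are relevant). -/
structure IsDualVectorOn (S : Set M) (r : M → A) : Prop where
  map_add : ∀ x ∈ S, ∀ y ∈ S, r (x + y) = r x + r y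
  map_smulC : ∀ (c : ℂ), ∀ x ∈ S, r (c • x) = c • r x
  map_smulA : ∀ (a : A), ∀ x ∈ S, r (a • x) = a * r x
  bound : ∃ C : ℝ, ∀ x ∈ S, ‖r x‖ ≤ C * ‖x‖

/-- The norm of a bounded `A`-linear map given on the subset `S`. -/
def dualNormOn (S : Set M) (r : M → A) : ℝ :=
  sInf {c : ℝ | 0 ≤ c ∧ ∀ x ∈ S, ‖r x‖ ≤ c * ‖x‖}

/-- The canonical embedding of `M` into its `A`-dual: `x ↦ ⟨·, x⟩`. -/
def toDualFun [HilbertCStarModule A M] (x : M) : M → A := fun y => hInner A y x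

/-- The canonical evaluation map of `M` into its `A`-bidual: `Ω x : r ↦ r x`. -/
def omegaFun (x : M) : (M → A) → A := fun r => r x

/-- A bounded `A`-linear functional on the `A`-dual `M'`, i.e. an element of the
`A`-bidual `M''`.  Here `M'` carries the `A`-action `(a • r) x = r x * (star a)`, and the
corresponding `A`-linearity for functionals on `M'` reads `F (a • r) = F r * star a`
(which holds for all evaluation functionals `Ω x`). -/
structure IsBidualVector (F : (M → A) → A) : Prop where
  map_add : ∀ r s : M → A, IsDualVector A r → IsDualVector A s →
    F (fun x => r x + s x) = F r + F s
  map_smulC : ∀ (c : ℂ) (r : M → A), IsDualVector A r →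
    F (fun x => c • r x) = c • F r
  map_smulA : ∀ (a : A) (r : M → A), IsDualVector A r →
    F (fun x => r x * star a) = F r * star a
  bound : ∃ C : ℝ, ∀ r : M → A, IsDualVector A r → ‖F r‖ ≤ C * dualNorm A r

/-- The norm of an element of the `A`-bidual. -/
def bidualNorm (F : (M → A) → A) : ℝ :=
  sInf {c : ℝ | 0 ≤ c ∧ ∀ r : M → A, IsDualVector A r → ‖F r‖ ≤ c * dualNorm A r}

/-- An element of the `A`-bidual `S''` of a submodule `S ⊆ M`, represented as a functional
on (representatives of) elements of the `A`-dual `S'`. -/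
structure IsBidualVectorOn (S : Set M) (F : (M → A) → A) : Prop where
  congr : ∀ r s : M → A, IsDualVectorOn A S r → IsDualVectorOn A S s →
    (∀ x ∈ S, r x = s x) → F r = F s
  map_add : ∀ r s : M → A, IsDualVectorOn A S r → IsDualVectorOn A S s →
    F (fun x => r x + s x) = F r + F s
  map_smulC : ∀ (c : ℂ) (r : M → A), IsDualVectorOn A S r →
    F (fun x => c • r x) = c • F r
  map_smulA : ∀ (a : A) (r : M → A), IsDualVectorOn A S r →
    F (fun x => r x * star a) = F r * star a
  bound : ∃ C : ℝ, ∀ r : M → A, IsDualVectorOn A S r → ‖F r‖ ≤ C * dualNormOn A S r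

/-- The norm of an element of the `A`-bidual of a submodule `S`. -/
def bidualNormOn (S : Set M) (F : (M → A) → A) : ℝ :=
  sInf {c : ℝ | 0 ≤ c ∧ ∀ r : M → A, IsDualVectorOn A S r → ‖F r‖ ≤ c * dualNormOn A S r}

/-- `M` is `A`-reflexive if the canonical map `Ω : M → M''` is surjective. -/
def IsCReflexive [HilbertCStarModule A M] : Prop :=
  ∀ F : (M → A) → A, IsBidualVector A F →
    ∃ x : M, ∀ r : M → A, IsDualVector A r → F r = r x

end Dual

section Order

/-- The C*-order relation: `x ≤ y` iff `y - x` is positive, i.e. of the form `c* c`. -/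
def cstarLE {B : Type*} [NonUnitalRing B] [Star B] (x y : B) : Prop :=
  ∃ c : B, y - x = star c * c

/-- `m` is the least upper bound of `S` with respect to the C*-order. -/
def IsCStarLUB {B : Type*} [NonUnitalRing B] [Star B] (S : Set B) (m : B) : Prop :=
  (∀ b ∈ S, cstarLE b m) ∧ ∀ u : B, (∀ b ∈ S, cstarLE b u) → cstarLE m u

/-- A C*-algebra is monotone complete if every norm-bounded increasingly directed set of
self-adjoint elements has a least upper bound. -/
def MonotoneComplete (B : Type*) [NonUnitalNormedRing B] [StarRing B] : Prop :=
  ∀ S : Set B, S.Nonempty → (∀ b ∈ S, star b = b) →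
    (∀ x ∈ S, ∀ y ∈ S, ∃ z ∈ S, cstarLE x z ∧ cstarLE y z) →
    (∃ C : ℝ, ∀ b ∈ S, ‖b‖ ≤ C) →
    ∃ m : B, IsCStarLUB S m

/-- A C*-algebra is additively complete if every family of positive elements whose finite
partial sums are norm-bounded has a least upper bound (of the set of its finite partial
sums). -/
def AdditivelyComplete (B : Type w) [NonUnitalNormedRing B] [StarRing B] : Prop :=
  ∀ (ι : Type w) (f : ι → B), (∀ i, ∃ c : B, f i = star c * c) →
    (∃ C : ℝ, ∀ s : Finset ι, ‖∑ i ∈ s, f i‖ ≤ C) →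
    ∃ m : B, IsCStarLUB {b : B | ∃ s : Finset ι, b = ∑ i ∈ s, f i} m

end Order

/-- The Hahn-Banach type extension property of a C*-algebra `A`: for every Hilbert
`A`-module `M` and every Hilbert `A`-submodule `N ⊆ M`, every bounded `A`-linear map
`r : N → A` extends to a bounded `A`-linear map `r' : M → A` with the same norm, with
`r'` restricted to `N` equal to `r` and `r'` vanishing on `N^⊥`. -/
def ExtensionProperty (A : Type u) [NonUnitalCStarAlgebra A] : Prop :=
  ∀ (M : Type v) [NormedAddCommGroup M] [NormedSpace ℂ M] [SMul A M]
    [HilbertCStarModule A M] (N : Set M), IsHilbertSubmodule A N →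
    ∀ r : M → A, IsDualVectorOn A N r →
      ∃ r' : M → A, IsDualVector A r' ∧ dualNorm A r' = dualNormOn A N r ∧
        (∀ x ∈ N, r' x = r x) ∧ (∀ x ∈ orthComp A N, r' x = 0)

section OrderLemma
variable {A : Type u} [NonUnitalCStarAlgebra A] [PartialOrder A] [StarOrderedRing A]

open Unitization CStarAlgebra in
/-- The order on a C*-algebra is detected by norms of conjugates. -/
theorem le_of_forall_norm_conjugate_le {p q : A} (hp : 0 ≤ p) (hq : 0 ≤ q)
    (h : ∀ a : A, ‖a * p * star a‖ ≤ ‖a * q * star a‖) : p ≤ q := by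
  rw [← inr_le_iff p q hp.isSelfAdjoint hq.isSelfAdjoint]
  have hP : (0 : Unitization ℂ A) ≤ p := inr_nonneg_iff.2 hp
  have hQ : (0 : Unitization ℂ A) ≤ q := inr_nonneg_iff.2 hq
  have key : ∀ ε : ℝ, 0 < ε → (p : Unitization ℂ A) ≤ q + algebraMap ℝ _ ε := by
    intro ε hε
    have hε' : IsStrictlyPositive (algebraMap ℝ (Unitization ℂ A) ε) :=
      isStrictlyPositive_algebraMap hε
    have hR : IsStrictlyPositive ((q : Unitization ℂ A) + algebraMap ℝ _ ε) :=
      IsStrictlyPositive.nonneg_add hQ hε'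
    rw [le_iff_norm_sqrt_mul_rpow _ _ hP hR]
    set R := (q : Unitization ℂ A) + algebraMap ℝ _ ε with hRdef
    set s : Unitization ℂ A := R ^ (-(1 / 2) : ℝ) with hs
    have hs0 : 0 ≤ s := CFC.rpow_nonneg
    have hsa : star s = s := hs0.isSelfAdjoint
    have hsR : s * R * s = 1 := CFC.conjugate_rpow_neg_one_half R hR
    have hsQ : s * (q : Unitization ℂ A) * s ≤ 1 := by
      rw [← hsR]
      have := star_left_conjugate_nonneg hε'.nonneg s
      rw [hsa] at this
      rw [hRdef, mul_add, add_mul]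
      exact le_add_of_nonneg_right this
    have hsQ0 : 0 ≤ s * (q : Unitization ℂ A) * s := by
      have := star_left_conjugate_nonneg hQ s
      rwa [hsa] at this
    have hsQn : ‖s * (q : Unitization ℂ A) * s‖ ≤ 1 := (norm_le_one_iff_of_nonneg _ hsQ0).2 hsQ
    obtain ⟨k, hk⟩ : ∃ k : A, (k : Unitization ℂ A) = s * p * s :=
      ⟨(s * p * s).snd, by ext <;> simp⟩
    have hks : star k = k := by
      apply Unitization.inr_injective (R := ℂ)
      rw [Unitization.inr_star, hk, star_mul, star_mul, hsa, ← Unitization.inr_star,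
        hp.isSelfAdjoint.star_eq, mul_assoc]
    obtain ⟨a, ha⟩ : ∃ a : A, (a : Unitization ℂ A) = k * s :=
      ⟨((k : Unitization ℂ A) * s).snd, by ext <;> simp⟩
    have has : ((star a : A) : Unitization ℂ A) = s * k := by
      rw [Unitization.inr_star, ha, star_mul, hsa, ← Unitization.inr_star, hks]
    have h1 := h a
    rw [← Unitization.norm_inr (𝕜 := ℂ), ← Unitization.norm_inr (𝕜 := ℂ) (a * q * star a)] at h1
    simp only [Unitization.inr_mul, has, ha] at h1
    have e1 : (k : Unitization ℂ A) * s * p * (s * k) = ((k * k * k : A) : Unitization ℂ A) := by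
      rw [Unitization.inr_mul, Unitization.inr_mul]
      nth_rw 4 [hk]
      simp only [mul_assoc]
    have e2 : (k : Unitization ℂ A) * s * q * (s * k) = k * (s * q * s) * k := by
      simp only [mul_assoc]
    rw [e1, e2, Unitization.norm_inr] at h1
    have h2 : ‖(k : Unitization ℂ A) * (s * q * s) * k‖ ≤ ‖k‖ * 1 * ‖k‖ := by
      refine (norm_mul_le _ _).trans ?_
      rw [Unitization.norm_inr]
      gcongr
      refine (norm_mul_le _ _).trans ?_
      rw [Unitization.norm_inr]
      gcongr
    have hkk : ‖k * k‖ = ‖k‖ * ‖k‖ := by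
      simpa only [hks] using CStarRing.norm_star_mul_self (x := k)
    have hkkkk : ‖k * k * k * k‖ = ‖k‖ * ‖k‖ * (‖k‖ * ‖k‖) := by
      have := CStarRing.norm_star_mul_self (x := k * k)
      rw [star_mul, hks, hkk] at this
      rw [← this, ← mul_assoc]
    have h3 : ‖k * k * k * k‖ ≤ ‖k * k * k‖ * ‖k‖ := norm_mul_le _ _
    have hk1 : ‖k‖ ≤ 1 := by
      by_contra hcon
      push Not at hcon
      have : ‖k * k * k‖ * ‖k‖ ≤ (‖k‖ * 1 * ‖k‖) * ‖k‖ := by gcongr; exact h1.trans h2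
      nlinarith [pow_pos (zero_lt_one.trans hcon) 3]
    have h4 : star (CFC.sqrt (p : Unitization ℂ A) * s) * (CFC.sqrt (p : Unitization ℂ A) * s)
        = k := by
      rw [star_mul, hsa, (CFC.sqrt_nonneg (p : Unitization ℂ A)).isSelfAdjoint.star_eq, hk,
        mul_assoc, ← mul_assoc (CFC.sqrt _), CFC.sqrt_mul_sqrt_self _ hP, mul_assoc]
    have h5 := CStarRing.norm_star_mul_self (x := CFC.sqrt (p : Unitization ℂ A) * s)
    rw [h4, Unitization.norm_inr] at h5
    by_contra hcon
    push Not at hcon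
    nlinarith
  have hlim : Filter.Tendsto (fun ε : ℝ => (q : Unitization ℂ A) + algebraMap ℝ _ ε)
      (nhdsWithin 0 (Set.Ioi 0)) (nhds ((q : Unitization ℂ A) + algebraMap ℝ _ 0)) := by
    apply Filter.Tendsto.mono_left _ nhdsWithin_le_nhds
    exact (continuous_const.add (algebraMapCLM ℝ (Unitization ℂ A)).continuous).tendsto 0
  rw [map_zero, add_zero] at hlim
  exact ge_of_tendsto hlim (by filter_upwards [self_mem_nhdsWithin] with ε hε using key ε hε)
end OrderLemma

section SemiInner

/-- An `A`-valued semi-inner product on a (possibly incomplete) left `A`-module `V`. -/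
structure IsSemiInner (A : Type u) [NonUnitalCStarAlgebra A] [PartialOrder A]
    {V : Type v} [AddCommGroup V] [Module ℂ V] [SMul A V] (B : V → V → A) : Prop where
  smul_add' : ∀ (a : A) (x y : V), a • (x + y) = a • x + a • y
  add_smul' : ∀ (a b : A) (x : V), (a + b) • x = a • x + b • x
  mul_smul' : ∀ (a b : A) (x : V), (a * b) • x = a • (b • x)
  smul_smul' : ∀ (c : ℂ) (a : A) (x : V), (c • a) • x = c • (a • x)
  add_left : ∀ x y z : V, B (x + y) z = B x z + B y z
  smulA_left : ∀ (a : A) (x y : V), B (a • x) y = a * B x y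
  smulC_left : ∀ (c : ℂ) (x y : V), B (c • x) y = c • B x y
  conj : ∀ x y : V, B x y = star (B y x)
  nonneg : ∀ x : V, 0 ≤ B x x

/-- The seminorm attached to a semi-inner product. -/
def semiNorm {A : Type u} [NonUnitalCStarAlgebra A] {V : Type v} (B : V → V → A) (x : V) : ℝ :=
  Real.sqrt ‖B x x‖

variable {A : Type u} [NonUnitalCStarAlgebra A]

theorem semiNorm_nonneg {V : Type v} (B : V → V → A) (x : V) : 0 ≤ semiNorm B x :=
  Real.sqrt_nonneg _

theorem semiNorm_sq {V : Type v} (B : V → V → A) (x : V) : semiNorm B x ^ 2 = ‖B x x‖ :=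
  Real.sq_sqrt (norm_nonneg _)

variable [PartialOrder A] 

namespace IsSemiInner

variable {V : Type v} [AddCommGroup V] [Module ℂ V] [SMul A V] {B : V → V → A}

theorem add_right (h : IsSemiInner A B) (x y z : V) : B x (y + z) = B x y + B x z := by
  rw [h.conj, h.add_left, star_add, ← h.conj, ← h.conj]

theorem smulA_right (h : IsSemiInner A B) (a : A) (x y : V) : B x (a • y) = B x y * star a := by
  rw [h.conj, h.smulA_left, star_mul, ← h.conj]

theorem smulC_right (h : IsSemiInner A B) (c : ℂ) (x y : V) : B x (c • y) = star c • B x y := by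
  rw [h.conj, h.smulC_left, star_smul, ← h.conj]

theorem zero_left (h : IsSemiInner A B) (y : V) : B 0 y = 0 := by
  simpa using h.smulC_left 0 0 y

theorem zero_right (h : IsSemiInner A B) (y : V) : B y 0 = 0 := by
  rw [h.conj, h.zero_left, star_zero]

theorem neg_left (h : IsSemiInner A B) (x y : V) : B (-x) y = -B x y := by
  simpa using h.smulC_left (-1) x y

theorem sub_left (h : IsSemiInner A B) (x y z : V) : B (x - y) z = B x z - B y z := by
  rw [sub_eq_add_neg, h.add_left, h.neg_left, sub_eq_add_neg]

theorem sub_right (h : IsSemiInner A B) (x y z : V) : B x (y - z) = B x y - B x z := by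
  rw [h.conj, h.sub_left, star_sub, ← h.conj, ← h.conj]

theorem smulA_zero (h : IsSemiInner A B) (a : A) : a • (0 : V) = 0 := by
  simpa using h.smul_add' a 0 0

theorem smulA_neg (h : IsSemiInner A B) (a : A) (x : V) : a • (-x) = -(a • x) := by
  rw [eq_neg_iff_add_eq_zero, ← h.smul_add', neg_add_cancel, h.smulA_zero]

theorem smulA_sub (h : IsSemiInner A B) (a : A) (x y : V) : a • (x - y) = a • x - a • y := by
  rw [sub_eq_add_neg, h.smul_add', h.smulA_neg, sub_eq_add_neg]

theorem semiNorm_smulC (h : IsSemiInner A B) (c : ℂ) (x : V) :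
    semiNorm B (c • x) = ‖c‖ * semiNorm B x := by
  rw [semiNorm, h.smulC_left, h.smulC_right, smul_smul, norm_smul, norm_mul, norm_star,
    Real.sqrt_mul (by positivity), Real.sqrt_mul_self (norm_nonneg _), semiNorm]

theorem semiNorm_smulA_le (h : IsSemiInner A B) (a : A) (x : V) :
    semiNorm B (a • x) ≤ ‖a‖ * semiNorm B x := by
  refine abs_le_of_sq_le_sq' ?_ (mul_nonneg (norm_nonneg _) (semiNorm_nonneg _ _)) |>.2
  rw [semiNorm_sq, h.smulA_left, h.smulA_right, mul_pow, semiNorm_sq]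
  have h1 := norm_mul_le a (B x x * star a)
  have h2 := norm_mul_le (B x x) (star a)
  rw [norm_star] at h2
  nlinarith [norm_nonneg a, norm_nonneg (B x x)]

variable [StarOrderedRing A]

theorem norm_sq_le (h : IsSemiInner A B) (x y : V) : ‖B x y‖ ^ 2 ≤ ‖B x x‖ * ‖B y y‖ := by
  have main : ∀ n : ℝ, ‖B y y‖ < n → ‖B x y‖ ^ 2 ≤ ‖B x x‖ * n := by
    intro n hn
    have hn0 : 0 < n := (norm_nonneg _).trans_lt hn
    set c := B x y * star (B x y) with hc
    have hc0 : 0 ≤ c := mul_star_self_nonneg _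
    set t : ℝ := 1 / n with ht
    have ht0 : 0 < t := by positivity
    have hpos := h.nonneg (x - ((t : ℂ) • B x y) • y)
    have hexp : B (x - ((t : ℂ) • B x y) • y) (x - ((t : ℂ) • B x y) • y)
        = B x x - (2 * t) • c + (t ^ 2) • (B x y * B y y * star (B x y)) := by
      rw [h.sub_left, h.sub_right, h.sub_right, h.smulA_left, h.smulA_left, h.smulA_right,
        h.smulA_right, h.conj y x, hc]
      simp only [star_smul, star_trivial, smul_mul_assoc, mul_smul_comm,
        Complex.coe_smul, mul_assoc]
      module
    rw [hexp] at hpos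
    have h1 : B x y * B y y * star (B x y) ≤ ‖B y y‖ • c :=
      CStarAlgebra.star_right_conjugate_le_norm_smul (h.nonneg y).isSelfAdjoint
    have h2 : t • c ≤ B x x := by
      have h3 : (t ^ 2) • (B x y * B y y * star (B x y)) ≤ (t ^ 2) • (‖B y y‖ • c) :=
        smul_le_smul_of_nonneg_left h1 (by positivity)
      have h4 : (t ^ 2) • (‖B y y‖ • c) ≤ t • c := by
        rw [smul_smul]
        refine smul_le_smul_of_nonneg_right ?_ hc0
        rw [pow_two, mul_assoc]
        have : t * ‖B y y‖ ≤ 1 := by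
          rw [ht, one_div, inv_mul_le_iff₀ hn0]; linarith
        nlinarith
      have h5 : (2 * t) • c = t • c + t • c := by module
      rw [h5] at hpos
      calc t • c = (t • c + t • c) - t • c := by abel
        _ ≤ (t • c + t • c) - (t ^ 2) • (B x y * B y y * star (B x y)) :=
            sub_le_sub_left (h3.trans h4) _
        _ ≤ B x x := by
            rw [← sub_nonneg]
            convert hpos using 1
            abel
    have h6 := CStarAlgebra.norm_le_norm_of_nonneg_of_le (smul_nonneg ht0.le hc0) h2
    rw [norm_smul, hc, CStarRing.norm_self_mul_star, Real.norm_of_nonneg ht0.le, ht, one_div,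
      inv_mul_le_iff₀ hn0] at h6
    nlinarith
  rcases (norm_nonneg (B x x)).eq_or_lt with h0 | h0
  · have := main (‖B y y‖ + 1) (by linarith)
    rw [← h0] at this ⊢
    simpa using this
  · rw [← div_le_iff₀' h0]
    refine le_of_forall_gt_imp_ge_of_dense fun n hn => ?_
    rw [div_le_iff₀' h0]
    exact main n hn

theorem norm_le (h : IsSemiInner A B) (x y : V) : ‖B x y‖ ≤ semiNorm B x * semiNorm B y := by
  refine abs_le_of_sq_le_sq' ?_ (mul_nonneg (semiNorm_nonneg _ _) (semiNorm_nonneg _ _)) |>.2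
  rw [mul_pow, semiNorm_sq, semiNorm_sq]
  exact h.norm_sq_le x y

theorem semiNorm_add_le (h : IsSemiInner A B) (x y : V) :
    semiNorm B (x + y) ≤ semiNorm B x + semiNorm B y := by
  have hx := semiNorm_nonneg B x
  have hy := semiNorm_nonneg B y
  refine abs_le_of_sq_le_sq' ?_ (add_nonneg hx hy) |>.2
  rw [semiNorm_sq, h.add_left, h.add_right, h.add_right]
  have h1 := h.norm_le x y
  have h2 := h.norm_le y x
  have h3 := norm_add_le (B x x + B x y) (B y x + B y y)
  have h4 := norm_add_le (B x x) (B x y)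
  have h5 := norm_add_le (B y x) (B y y)
  have h6 := semiNorm_sq B x
  have h7 := semiNorm_sq B y
  nlinarith

end IsSemiInner

/-- A norm bound on an `A`-linear functional gives a bound in the order of `A`. -/
theorem mul_star_le_of_norm_sq_le [StarOrderedRing A] {V : Type v} [SMul A V] {f : V → A}
    (hf : ∀ (a : A) (x : V), f (a • x) = a * f x) {C : ℝ} (hC : 0 ≤ C) {Q : V → A}
    (hQ : ∀ x, 0 ≤ Q x) (hQa : ∀ (a : A) (x : V), Q (a • x) = a * Q x * star a)
    (hb : ∀ x, ‖f x‖ ^ 2 ≤ C * ‖Q x‖) (x : V) : f x * star (f x) ≤ C • Q x := by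
  refine le_of_forall_norm_conjugate_le (mul_star_self_nonneg _) (smul_nonneg hC (hQ x)) ?_
  intro a
  have := hb (a • x)
  rw [hf, hQa] at this
  calc ‖a * (f x * star (f x)) * star a‖ = ‖(a * f x) * star (a * f x)‖ := by
        rw [star_mul]; simp only [mul_assoc]
    _ = ‖a * f x‖ ^ 2 := by rw [CStarRing.norm_self_mul_star, pow_two]
    _ ≤ C * ‖a * Q x * star a‖ := this
    _ = ‖a * (C • Q x) * star a‖ := by
        rw [mul_smul_comm, smul_mul_assoc, norm_smul, Real.norm_of_nonneg hC]

end SemiInner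

section HilbertModule

variable {A : Type u} [NonUnitalCStarAlgebra A]

theorem IsDualVector.norm_le {M : Type v} [NormedAddCommGroup M] [NormedSpace ℂ M] [SMul A M]
    {r : M → A} (hr : IsDualVector A r) (x : M) : ‖r x‖ ≤ dualNorm A r * ‖x‖ := by
  rcases eq_or_ne x 0 with rfl | hx
  · have : r 0 = 0 := by simpa using hr.map_smulC 0 0
    simp [this]
  · have hx0 : 0 < ‖x‖ := norm_pos_iff.2 hx
    rw [← div_le_iff₀ hx0]
    obtain ⟨C, hC⟩ := hr.bound
    refine le_csInf ⟨max C 0, le_max_right _ _, fun y => (hC y).trans ?_⟩ ?_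
    · gcongr
      exact le_max_left _ _
    · rintro c ⟨-, hc⟩
      rw [div_le_iff₀ hx0]
      exact hc x

theorem dualNorm_nonneg {M : Type v} [NormedAddCommGroup M] [NormedSpace ℂ M] [SMul A M]
    (r : M → A) : 0 ≤ dualNorm A r :=
  Real.sInf_nonneg fun _ hc => hc.1

theorem dualNormOn_le {M : Type v} [NormedAddCommGroup M] [NormedSpace ℂ M] [SMul A M]
    {S : Set M} {r : M → A} {C : ℝ} (hC : 0 ≤ C) (h : ∀ x ∈ S, ‖r x‖ ≤ C * ‖x‖) :
    dualNormOn A S r ≤ C :=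
  csInf_le ⟨0, fun _ hc => hc.1⟩ ⟨hC, h⟩

theorem semiNorm_hInner {M : Type v} [NormedAddCommGroup M] [NormedSpace ℂ M] [SMul A M]
    [HilbertCStarModule A M] (x : M) : semiNorm (hInner A (M := M)) x = ‖x‖ :=
  (HilbertCStarModule.norm_eq (A := A) x).symm

variable [PartialOrder A] [StarOrderedRing A]

theorem isSemiInner_hInner (M : Type v) [NormedAddCommGroup M] [NormedSpace ℂ M] [SMul A M]
    [HilbertCStarModule A M] : IsSemiInner A (hInner A (M := M)) where
  smul_add' := HilbertCStarModule.smul_add'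
  add_smul' := HilbertCStarModule.add_smul'
  mul_smul' := HilbertCStarModule.mul_smul'
  smul_smul' := HilbertCStarModule.smul_smul'
  add_left := HilbertCStarModule.inner_add_left
  smulA_left := HilbertCStarModule.inner_smulA_left
  smulC_left := HilbertCStarModule.inner_smulC_left
  conj := HilbertCStarModule.inner_conj
  nonneg x := by
    obtain ⟨b, hb⟩ := HilbertCStarModule.inner_self_pos (A := A) x
    rw [hInner, hb]
    exact star_mul_self_nonneg b

/-- A bounded functional given along a module map `e : W → H` extends to all of `H`. -/
theorem ExtensionProperty.exists_extension_of_module (hext : ExtensionProperty.{u, v} A)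
    {H : Type v} [NormedAddCommGroup H] [NormedSpace ℂ H] [SMul A H] [HilbertCStarModule A H]
    {W : Type w} [AddCommGroup W] [Module ℂ W] [SMul A W] (e : W →ₗ[ℂ] H)
    (he : ∀ (a : A) x, e (a • x) = a • e x) (f : W →ₗ[ℂ] A)
    (hf : ∀ (a : A) x, f (a • x) = a * f x) {C : ℝ} (hC : 0 ≤ C)
    (hb : ∀ x, ‖f x‖ ≤ C * ‖e x‖) :
    ∃ g : H → A, IsDualVector A g ∧ (∀ x, ‖g x‖ ≤ C * ‖x‖) ∧ ∀ x, g (e x) = f x := by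
  have hH := isSemiInner_hInner (A := A) H
  have hcont : ∀ a : A, Continuous fun x : H => a • x := by
    intro a
    have : LipschitzWith ⟨‖a‖, norm_nonneg a⟩ fun x : H => a • x := by
      refine LipschitzWith.of_dist_le_mul fun x y => ?_
      rw [dist_eq_norm, dist_eq_norm, ← hH.smulA_sub, ← semiNorm_hInner (A := A),
        ← semiNorm_hInner (A := A) (x - y)]
      exact hH.semiNorm_smulA_le a _
    exact this.continuous
  set N : Submodule ℂ H := (LinearMap.range e).topologicalClosure with hN
  have hNsmul : ∀ (a : A) (x : H), x ∈ N → a • x ∈ N := by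
    intro a x hx
    have : Set.MapsTo (fun x : H => a • x) (LinearMap.range e : Set H) (LinearMap.range e) := by
      rintro _ ⟨y, rfl⟩
      exact ⟨a • y, he a y⟩
    exact this.closure (hcont a) hx
  let e' : W →ₗ[ℂ] N := e.codRestrict N fun x => subset_closure ⟨x, rfl⟩
  have hd : DenseRange e' := by
    intro x
    rw [closure_subtype]
    have : (Subtype.val '' Set.range e' : Set H) = (LinearMap.range e : Set H) := by
      ext y
      simp only [Set.mem_image, Set.mem_range, exists_exists_eq_and, SetLike.mem_coe,
        LinearMap.mem_range]
      rfl
    rw [this]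
    exact x.2
  let φ : N →L[ℂ] A := f.extendOfNorm e'
  have hφe : ∀ x, φ (e' x) = f x := fun x => LinearMap.extendOfNorm_eq hd ⟨C, hb⟩ x
  have hφb : ∀ x, ‖φ x‖ ≤ C * ‖x‖ := LinearMap.norm_extendOfNorm_apply_le hd C hb
  have hφA : ∀ (a : A) (x : N), φ ⟨a • (x : H), hNsmul a x x.2⟩ = a * φ x := by
    intro a x
    have hc1 : Continuous fun x : N => φ ⟨a • (x : H), hNsmul a x x.2⟩ :=
      φ.continuous.comp (((hcont a).comp continuous_subtype_val).subtype_mk _)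
    refine congrFun (hd.equalizer hc1 (continuous_const.mul φ.continuous) ?_) x
    funext y
    have : (⟨a • (e' y : H), hNsmul a _ (e' y).2⟩ : N) = e' (a • y) :=
      Subtype.ext (he a y).symm
    change φ _ = a * φ (e' y)
    rw [this, hφe, hφe, hf]
  classical
  let r : H → A := fun x => if hx : x ∈ N then φ ⟨x, hx⟩ else 0
  have hr : ∀ x (hx : x ∈ N), r x = φ ⟨x, hx⟩ := fun x hx => dif_pos hx
  have hrb : ∀ x ∈ (N : Set H), ‖r x‖ ≤ C * ‖x‖ := fun x hx => by
    rw [hr x hx]; exact hφb ⟨x, hx⟩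
  have hsub : IsHilbertSubmodule A (N : Set H) :=
    { isClosed := Submodule.isClosed_topologicalClosure _
      zero_mem := N.zero_mem
      add_mem := fun _ _ => N.add_mem
      smulC_mem := fun c _ => N.smul_mem c
      smulA_mem := hNsmul }
  have hdual : IsDualVectorOn A (N : Set H) r :=
    { map_add := fun x hx y hy => by
        rw [hr x hx, hr y hy, hr _ (N.add_mem hx hy), ← map_add]; rfl
      map_smulC := fun c x hx => by
        rw [hr x hx, hr _ (N.smul_mem c hx), ← map_smul]; rfl
      map_smulA := fun a x hx => by
        rw [hr x hx, hr _ (hNsmul a x hx), ← hφA]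
      bound := ⟨C, hrb⟩ }
  obtain ⟨g, hg, hgn, hgr, -⟩ := hext H N hsub r hdual
  refine ⟨g, hg, fun x => (hg.norm_le x).trans ?_, fun x => ?_⟩
  · gcongr
    rw [hgn]
    exact dualNormOn_le hC hrb
  · exact (hgr _ (e' x).2).trans ((hr _ (e' x).2).trans (hφe x))

end HilbertModule

section Completion

open UniformSpace Function

variable {A : Type u} [NonUnitalCStarAlgebra A] [PartialOrder A]
  {V : Type v} [SeminormedAddCommGroup V] [NormedSpace ℂ V] [SMul A V] {B : V → V → A}

theorem IsSemiInner.uniformContinuousConstSMul (h : IsSemiInner A B)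
    (hn : ∀ x : V, ‖x‖ = semiNorm B x) : UniformContinuousConstSMul A V where
  uniformContinuous_const_smul a := by
    have : LipschitzWith ⟨‖a‖, norm_nonneg a⟩ fun x : V => a • x := by
      refine LipschitzWith.of_dist_le_mul fun x y => ?_
      rw [dist_eq_norm, dist_eq_norm, ← h.smulA_sub, hn, hn]
      exact h.semiNorm_smulA_le a _
    exact this.uniformContinuous

variable [StarOrderedRing A]

/-- The continuous extension of a pairing to the completion. -/
def completionInner (B : V → V → A) : Completion V → Completion V → A :=
  curry ((Completion.isDenseInducing_coe.prodMap Completion.isDenseInducing_coe).extend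
    (uncurry B))

theorem IsSemiInner.continuous_uncurry (h : IsSemiInner A B)
    (hn : ∀ x : V, ‖x‖ = semiNorm B x) : Continuous (uncurry B) := by
  rw [continuous_iff_continuousAt]
  rintro ⟨x, y⟩
  have hle : ∀ p : V × V, ‖uncurry B p - uncurry B (x, y)‖ ≤
      ‖p.1 - x‖ * ‖p.2‖ + ‖x‖ * ‖p.2 - y‖ := by
    rintro ⟨p, q⟩
    have : uncurry B (p, q) - uncurry B (x, y) = B (p - x) q + B x (q - y) := by
      simp only [uncurry, h.sub_left, h.sub_right]
      abel
    rw [this, hn, hn, hn, hn]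
    exact (norm_add_le _ _).trans (add_le_add (h.norm_le _ _) (h.norm_le _ _))
  rw [ContinuousAt, tendsto_iff_norm_sub_tendsto_zero]
  refine squeeze_zero (fun _ => norm_nonneg _) hle ?_
  have hc : Continuous fun p : V × V => ‖p.1 - x‖ * ‖p.2‖ + ‖x‖ * ‖p.2 - y‖ := by fun_prop
  have := hc.tendsto (x, y)
  simpa using this

theorem IsSemiInner.completionInner_coe (h : IsSemiInner A B)
    (hn : ∀ x : V, ‖x‖ = semiNorm B x) (x y : V) :
    completionInner B (x : Completion V) (y : Completion V) = B x y :=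
  (Completion.isDenseInducing_coe.prodMap Completion.isDenseInducing_coe).extend_eq
    (h.continuous_uncurry hn) (x, y)

theorem IsSemiInner.continuous_completionInner (h : IsSemiInner A B)
    (hn : ∀ x : V, ‖x‖ = semiNorm B x) : Continuous (uncurry (completionInner B)) := by
  let B' : V →+ V →+ A :=
    { toFun := fun x =>
        { toFun := B x
          map_zero' := h.zero_right x
          map_add' := h.add_right x }
      map_zero' := by ext x; exact h.zero_left x
      map_add' := fun x y => by ext z; exact h.add_left x y z }
  have : Continuous fun p : V × V => B' p.1 p.2 := h.continuous_uncurry hn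
  rw [completionInner, uncurry_curry]
  change Continuous (((Completion.isDenseInducing_toCompl V).prodMap
    (Completion.isDenseInducing_toCompl V)).extend fun p : V × V => B' p.1 p.2)
  exact (Completion.isDenseInducing_toCompl V).extend_Z_bilin
    (Completion.isDenseInducing_toCompl V) this

/-- The completion of a semi-inner product module is a Hilbert C*-module. -/
abbrev IsSemiInner.completionModule (h : IsSemiInner A B)
    (hn : ∀ x : V, ‖x‖ = semiNorm B x) [UniformContinuousConstSMul A V] :
    HilbertCStarModule A (Completion V) :=
  have hc := h.continuous_completionInner hn
  have hc' : ∀ {X : Type v} [TopologicalSpace X] {f g : X → Completion V}, Continuous f →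
      Continuous g → Continuous fun x => completionInner B (f x) (g x) :=
    fun hf hg => hc.comp (hf.prodMk hg :)
  have hnorm : ∀ x : Completion V, ‖x‖ = Real.sqrt ‖completionInner B x x‖ := fun x =>
    Completion.induction_on x (isClosed_eq continuous_norm
      (hc' continuous_id continuous_id).norm.sqrt) fun a => by
        rw [Completion.norm_coe, h.completionInner_coe hn, hn, semiNorm]
  { inner := completionInner B
    smul_add' := fun a x y => Completion.induction_on₂ x y
      (isClosed_eq ((continuous_fst.add continuous_snd).const_smul a)
        ((continuous_fst.const_smul a).add (continuous_snd.const_smul a))) fun x y => by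
        rw [← Completion.coe_add, ← Completion.coe_smul, h.smul_add', Completion.coe_add,
          Completion.coe_smul, Completion.coe_smul]
    add_smul' := fun a b x => Completion.induction_on x
      (isClosed_eq (continuous_const_smul _)
        ((continuous_const_smul a).add (continuous_const_smul b))) fun x => by
        rw [← Completion.coe_smul, h.add_smul', Completion.coe_add,
          Completion.coe_smul, Completion.coe_smul]
    mul_smul' := fun a b x => Completion.induction_on x
      (isClosed_eq (continuous_const_smul _) ((continuous_const_smul b).const_smul a))
      fun x => by
        rw [← Completion.coe_smul, h.mul_smul', Completion.coe_smul, Completion.coe_smul]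
    smul_smul' := fun a b x => Completion.induction_on x
      (isClosed_eq (continuous_const_smul _) ((continuous_const_smul b).const_smul a))
      fun x => by
        rw [← Completion.coe_smul, h.smul_smul', Completion.coe_smul, Completion.coe_smul]
    inner_add_left := fun x y z => Completion.induction_on₃ x y z
      (isClosed_eq (hc' (continuous_fst.add (continuous_fst.comp continuous_snd))
          (continuous_snd.comp continuous_snd))
        ((hc' continuous_fst (continuous_snd.comp continuous_snd)).add
          (hc' (continuous_fst.comp continuous_snd) (continuous_snd.comp continuous_snd))))
      fun x y z => by
        rw [← Completion.coe_add, h.completionInner_coe hn, h.completionInner_coe hn,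
          h.completionInner_coe hn, h.add_left]
    inner_smulA_left := fun a x y => Completion.induction_on₂ x y
      (isClosed_eq (hc' (continuous_fst.const_smul a) continuous_snd)
        (continuous_const.mul (hc' continuous_fst continuous_snd))) fun x y => by
        rw [← Completion.coe_smul, h.completionInner_coe hn, h.completionInner_coe hn,
          h.smulA_left]
    inner_smulC_left := fun a x y => Completion.induction_on₂ x y
      (isClosed_eq (hc' (continuous_fst.const_smul a) continuous_snd)
        ((hc' continuous_fst continuous_snd).const_smul a)) fun x y => by
        rw [← Completion.coe_smul, h.completionInner_coe hn, h.completionInner_coe hn,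
          h.smulC_left]
    inner_conj := fun x y => Completion.induction_on₂ x y
      (isClosed_eq (hc' continuous_fst continuous_snd)
        ((hc' continuous_snd continuous_fst).star)) fun x y => by
        rw [h.completionInner_coe hn, h.completionInner_coe hn]
        exact h.conj x y
    inner_self_pos := fun x => by
      have : 0 ≤ completionInner B x x := Completion.induction_on x
        (isClosed_le continuous_const (hc' continuous_id continuous_id)) fun x => by
          rw [h.completionInner_coe hn]
          exact h.nonneg x
      exact CStarAlgebra.nonneg_iff_eq_star_mul_self.1 this
    inner_self_eq_zero := fun x => by
      rw [← norm_eq_zero, ← norm_eq_zero (a := x), hnorm, Real.sqrt_eq_zero (norm_nonneg _)]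
    norm_eq := hnorm
    complete := inferInstance }

end Completion

section Extension

open UniformSpace

variable {A : Type u} [NonUnitalCStarAlgebra A] [PartialOrder A] [StarOrderedRing A]

/-- The extension property for functionals on (possibly degenerate and incomplete)
semi-inner product modules. -/
theorem ExtensionProperty.exists_extension (hext : ExtensionProperty.{u, v} A)
    {V : Type v} [AddCommGroup V] [Module ℂ V] [SMul A V] {B : V → V → A}
    (hB : IsSemiInner A B) {W : Type w} [AddCommGroup W] [Module ℂ W] [SMul A W]
    (e : W →ₗ[ℂ] V) (he : ∀ (a : A) x, e (a • x) = a • e x) (f : W →ₗ[ℂ] A)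
    (hf : ∀ (a : A) x, f (a • x) = a * f x) {C : ℝ} (hC : 0 ≤ C)
    (hb : ∀ x, ‖f x‖ ≤ C * semiNorm B (e x)) :
    ∃ g : V →ₗ[ℂ] A, (∀ (a : A) x, g (a • x) = a * g x) ∧
      (∀ x, ‖g x‖ ≤ C * semiNorm B x) ∧ ∀ x, g (e x) = f x := by
  let _ : Norm V := ⟨semiNorm B⟩
  have core : SeminormedSpace.Core ℂ V :=
    ⟨semiNorm_nonneg B, hB.semiNorm_smulC, hB.semiNorm_add_le⟩
  let _ : SeminormedAddCommGroup V := SeminormedAddCommGroup.ofCore core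
  let _ : NormedSpace ℂ V := ⟨fun c x => (hB.semiNorm_smulC c x).le⟩
  have hn : ∀ x : V, ‖x‖ = semiNorm B x := fun _ => rfl
  have := hB.uniformContinuousConstSMul hn
  let := hB.completionModule hn
  obtain ⟨g, hg, hgb, hge⟩ := hext.exists_extension_of_module (H := Completion V)
    ((Completion.toComplₗᵢ (𝕜 := ℂ) (E := V)).toLinearMap ∘ₗ e)
    (fun a x => by simp [he, Completion.coe_smul]) f hf hC (fun x => by simpa [hn] using hb x)
  refine ⟨{ toFun := fun x => g (x : Completion V), map_add' := fun x y => ?_,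
            map_smul' := fun c x => ?_ }, fun a x => ?_, fun x => ?_, fun x => hge x⟩
  · rw [Completion.coe_add, hg.map_add]
  · rw [Completion.coe_smul, hg.map_smulC]; rfl
  · change g _ = a * g _
    rw [Completion.coe_smul, hg.map_smulA]
  · simpa [hn] using hgb (x : Completion V)

end Extension

section Families

variable {A : Type u} [NonUnitalCStarAlgebra A]

/-- The `A`-linear functionals on an `A`-module are determined by endomaps of the module. -/
theorem small_moduleFunctional (L : Type v) [AddCommGroup L] [Module ℂ L] [SMul A L]
    (hsub : ∀ (a b : A) (x : L), (a + b) • x = a • x + b • x) :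
    Small.{v} {d : L →ₗ[ℂ] A // ∀ (a : A) (x : L), d (a • x) = a * d x} := by
  refine small_of_injective (β := L → L → L) (f := fun d x l => star (d.1 x) • l) ?_
  intro d d' h
  ext x
  have h1 : star (d.1 x) • x = star (d'.1 x) • x := congrFun (congrFun h x) x
  have hz : star (d.1 x - d'.1 x) • x = 0 := by
    have := hsub (star (d.1 x - d'.1 x)) (star (d'.1 x)) x
    rw [← star_add, sub_add_cancel, h1] at this
    exact left_eq_add.1 (this.trans (add_comm _ _))
  have h2 : star (d.1 x - d'.1 x) * (d.1 x - d'.1 x) = 0 := by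
    rw [mul_sub, ← d.2, ← d'.2, hz, map_zero, map_zero, sub_zero]
  exact sub_eq_zero.1 ((CStarRing.star_mul_self_eq_zero_iff _).1 h2)

variable [PartialOrder A] [StarOrderedRing A]

/-- There is a maximal Bessel family of `A`-linear functionals vanishing on a given set. -/
theorem IsSemiInner.exists_maximal_family {L : Type v} [AddCommGroup L] [Module ℂ L] [SMul A L]
    {B : L → L → A} (hB : IsSemiInner A B) (R : Set L) :
    ∃ (K : Type v) (d : K → L →ₗ[ℂ] A), (∀ k (a : A) x, d k (a • x) = a * d k x) ∧
      (∀ k, ∀ y ∈ R, d k y = 0) ∧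
      (∀ (F : Finset K) x, ∑ k ∈ F, d k x * star (d k x) ≤ B x x) ∧
      ∀ δ : L →ₗ[ℂ] A, (∀ (a : A) x, δ (a • x) = a * δ x) → (∀ y ∈ R, δ y = 0) →
        (∀ (F : Finset K) x, δ x * star (δ x) + ∑ k ∈ F, d k x * star (d k x) ≤ B x x) →
        δ = 0 := by
  classical
  let D := {d : L →ₗ[ℂ] A // ∀ (a : A) (x : L), d (a • x) = a * d x}
  have : Small.{v} D := small_moduleFunctional L hB.add_smul'
  let K₀ := Shrink.{v} (D × ℕ)
  let d : K₀ → L →ₗ[ℂ] A := fun k => ((equivShrink (D × ℕ)).symm k).1.1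
  have hdA : ∀ k (a : A) x, d k (a • x) = a * d k x := fun k =>
    ((equivShrink (D × ℕ)).symm k).1.2
  let S : Set (Set K₀) := {T | (∀ k ∈ T, ∀ y ∈ R, d k y = 0) ∧
    ∀ F : Finset K₀, (F : Set K₀) ⊆ T → ∀ x, ∑ k ∈ F, d k x * star (d k x) ≤ B x x}
  obtain ⟨T, hT⟩ : ∃ T, Maximal (· ∈ S) T := by
    refine zorn_subset S fun c hcS hc => ⟨⋃₀ c, ⟨?_, fun F hF => ?_⟩,
      fun s hs => Set.subset_sUnion_of_mem hs⟩
    · rintro k ⟨t, ht, hk⟩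
      exact (hcS ht).1 k hk
    · rcases c.eq_empty_or_nonempty with rfl | hne
      · intro x
        have : F = ∅ := by simpa using hF
        simpa [this] using hB.nonneg x
      · obtain ⟨t, ht, hFt⟩ := hc.directedOn.exists_mem_subset_of_finite_of_subset_sUnion hne
          F.finite_toSet hF
        exact (hcS ht).2 F hFt
  have hTS : T ∈ S := hT.prop
  refine ⟨T, fun k => d k, fun k => hdA k, fun k => hTS.1 k k.2, fun F x => ?_, ?_⟩
  · have := hTS.2 (F.map (Function.Embedding.subtype _)) (by
      intro k hk
      obtain ⟨k', -, rfl⟩ := Finset.mem_map.1 (Finset.mem_coe.1 hk)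
      exact k'.2) x
    rwa [Finset.sum_map] at this
  · intro δ hδA hδR hδ
    let κ : ℕ → K₀ := fun n => equivShrink (D × ℕ) (⟨δ, hδA⟩, n)
    have hκ : ∀ n, d (κ n) = δ := fun n => by
      simp [κ, d]
    have hκinj : Function.Injective κ := fun m n h => by
      simpa using (equivShrink (D × ℕ)).injective h
    have hmem : ∀ n, κ n ∈ T := by
      intro n
      refine hT.le_of_ge (y := insert (κ n) T) ⟨?_, fun F hF x => ?_⟩ (Set.subset_insert _ _)
        (Set.mem_insert _ _)
      · rintro k (rfl | hk)
        · rw [hκ]; exact hδR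
        · exact hTS.1 k hk
      · by_cases hn : κ n ∈ F
        · rw [← Finset.add_sum_erase _ _ hn, hκ]
          have hsub : ∀ k ∈ F.erase (κ n), k ∈ T := fun k hk => by
            rw [Finset.mem_erase] at hk
            exact (hF hk.2).resolve_left hk.1
          have := hδ ((F.erase (κ n)).subtype (· ∈ T)) x
          rwa [Finset.sum_subtype_of_mem (fun k => d k x * star (d k x)) hsub] at this
        · refine hTS.2 F (fun k hk => (hF hk).resolve_left ?_) x
          rintro rfl
          exact hn hk
    ext x
    have hle : ∀ n : ℕ, (n : ℝ) * ‖δ x * star (δ x)‖ ≤ ‖B x x‖ := by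
      intro n
      have := hTS.2 ((Finset.range n).map ⟨κ, hκinj⟩) (by
        intro k hk
        obtain ⟨m, -, rfl⟩ := Finset.mem_map.1 (Finset.mem_coe.1 hk)
        exact hmem m) x
      simp only [Finset.sum_map, Function.Embedding.coeFn_mk, hκ, Finset.sum_const,
        Finset.card_range] at this
      have h2 := CStarAlgebra.norm_le_norm_of_nonneg_of_le
        (nsmul_nonneg (mul_star_self_nonneg (δ x)) n) this
      rwa [← Nat.cast_smul_eq_nsmul ℝ, norm_smul, Real.norm_natCast] at h2
    have h0 : ‖δ x * star (δ x)‖ = 0 := by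
      by_contra hne
      have hpos : 0 < ‖δ x * star (δ x)‖ := lt_of_le_of_ne (norm_nonneg _) (Ne.symm hne)
      obtain ⟨n, hn⟩ := exists_nat_gt (‖B x x‖ / ‖δ x * star (δ x)‖)
      rw [div_lt_iff₀ hpos] at hn
      exact absurd (hle n) (not_le.2 hn)
    exact (CStarRing.mul_star_self_eq_zero_iff _).1 (norm_eq_zero.1 h0)

end Families

section Perturbation

open Classical in
/-- The pairing on `L × (K →₀ L)` obtained from a pairing `B` on `L` by replacing, for each
index `k`, the contribution of the functional `d k` at `x` by its value at `x + w k`. -/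
def perturbedInner {A : Type u} [NonUnitalCStarAlgebra A] {L : Type v} [AddCommGroup L]
    [Module ℂ L] {K : Type v} (B : L → L → A) (d : K → L →ₗ[ℂ] A) (p q : L × (K →₀ L)) : A :=
  B p.1 q.1 + ∑ k ∈ p.2.support ∪ q.2.support,
    (d k (p.1 + p.2 k) * star (d k (q.1 + q.2 k)) - d k p.1 * star (d k q.1))

variable {A : Type u} [NonUnitalCStarAlgebra A]
  {L : Type v} [AddCommGroup L] [Module ℂ L] {K : Type v} {B : L → L → A} {d : K → L →ₗ[ℂ] A}

theorem perturbedInner_eq (p q : L × (K →₀ L)) {F : Finset K} (hp : p.2.support ⊆ F)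
    (hq : q.2.support ⊆ F) : perturbedInner B d p q = B p.1 q.1 + ∑ k ∈ F,
      (d k (p.1 + p.2 k) * star (d k (q.1 + q.2 k)) - d k p.1 * star (d k q.1)) := by
  classical
  rw [perturbedInner]
  congr 1
  refine Finset.sum_subset (Finset.union_subset hp hq) fun k _ hk => ?_
  simp only [Finset.mem_union, Finsupp.mem_support_iff, not_or, not_not] at hk
  rw [hk.1, hk.2, add_zero, add_zero, sub_self]

theorem perturbedInner_self (p : L × (K →₀ L)) {F : Finset K} (hp : p.2.support ⊆ F) :
    perturbedInner B d p p = (B p.1 p.1 - ∑ k ∈ F, d k p.1 * star (d k p.1)) +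
      ∑ k ∈ F, d k (p.1 + p.2 k) * star (d k (p.1 + p.2 k)) := by
  rw [perturbedInner_eq p p hp hp, Finset.sum_sub_distrib]
  abel

theorem perturbedInner_mk_zero (x y : L) : perturbedInner B d (x, 0) (y, 0) = B x y := by
  simp [perturbedInner]

variable [PartialOrder A] [StarOrderedRing A] [SMul A L]

theorem IsSemiInner.perturbedInner [SMul A (K →₀ L)]
    (hs : ∀ (a : A) (w : K →₀ L) k, (a • w) k = a • w k) (hB : IsSemiInner A B)
    (hdA : ∀ k (a : A) x, d k (a • x) = a * d k x)
    (hd : ∀ (F : Finset K) x, ∑ k ∈ F, d k x * star (d k x) ≤ B x x) :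
    IsSemiInner A (perturbedInner B d) := by
  classical
  refine ⟨fun a x y => ?_, fun a b x => ?_, fun a b x => ?_, fun a b x => ?_, fun x y z => ?_,
    fun a x y => ?_, fun c x y => ?_, fun x y => ?_, fun x => ?_⟩
  · refine Prod.ext (hB.smul_add' _ _ _) (Finsupp.ext fun k => ?_)
    simp [hs, hB.smul_add']
  · refine Prod.ext (hB.add_smul' _ _ _) (Finsupp.ext fun k => ?_)
    simp [hs, hB.add_smul']
  · refine Prod.ext (hB.mul_smul' _ _ _) (Finsupp.ext fun k => ?_)
    simp [hs, hB.mul_smul']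
  · refine Prod.ext (hB.smul_smul' _ _ _) (Finsupp.ext fun k => ?_)
    simp [hs, hB.smul_smul']
  · have h1 : x.2.support ⊆ x.2.support ∪ y.2.support ∪ z.2.support := by grind
    have h2 : y.2.support ⊆ x.2.support ∪ y.2.support ∪ z.2.support := by grind
    have h3 : z.2.support ⊆ x.2.support ∪ y.2.support ∪ z.2.support := by grind
    have h4 : (x + y).2.support ⊆ x.2.support ∪ y.2.support ∪ z.2.support :=
      Finsupp.support_add.trans (Finset.union_subset h1 h2)
    rw [perturbedInner_eq _ _ h4 h3, perturbedInner_eq _ _ h1 h3, perturbedInner_eq _ _ h2 h3,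
      Prod.fst_add, hB.add_left, add_add_add_comm, ← Finset.sum_add_distrib]
    refine congrArg _ (Finset.sum_congr rfl fun k _ => ?_)
    simp only [Prod.snd_add, Finsupp.add_apply, map_add, add_mul]
    abel
  · have h1 : x.2.support ⊆ x.2.support ∪ y.2.support := Finset.subset_union_left
    have h2 : y.2.support ⊆ x.2.support ∪ y.2.support := Finset.subset_union_right
    have h3 : (a • x).2.support ⊆ x.2.support ∪ y.2.support := by
      refine subset_trans (fun k hk => ?_) h1
      rw [Finsupp.mem_support_iff] at hk ⊢
      refine fun h0 => hk ?_
      rw [Prod.smul_snd, hs, h0, hB.smulA_zero]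
    rw [perturbedInner_eq _ _ h3 h2, perturbedInner_eq _ _ h1 h2,
      Prod.smul_fst, hB.smulA_left, mul_add, Finset.mul_sum]
    refine congrArg _ (Finset.sum_congr rfl fun k _ => ?_)
    rw [Prod.smul_snd, hs, ← hB.smul_add', hdA, hdA, mul_assoc, mul_assoc, mul_sub]
  · have h1 : x.2.support ⊆ x.2.support ∪ y.2.support := Finset.subset_union_left
    have h2 : y.2.support ⊆ x.2.support ∪ y.2.support := Finset.subset_union_right
    have h3 : (c • x).2.support ⊆ x.2.support ∪ y.2.support :=
      Finsupp.support_smul.trans h1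
    rw [perturbedInner_eq _ _ h3 h2, perturbedInner_eq _ _ h1 h2,
      Prod.smul_fst, hB.smulC_left, smul_add, Finset.smul_sum]
    refine congrArg _ (Finset.sum_congr rfl fun k _ => ?_)
    rw [Prod.smul_snd, Finsupp.smul_apply, ← smul_add, map_smul, map_smul, smul_mul_assoc,
      smul_mul_assoc, smul_sub]
  · have h1 : x.2.support ⊆ x.2.support ∪ y.2.support := Finset.subset_union_left
    have h2 : y.2.support ⊆ x.2.support ∪ y.2.support := Finset.subset_union_right
    rw [perturbedInner_eq _ _ h1 h2, perturbedInner_eq _ _ h2 h1, star_add, star_sum,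
      ← hB.conj]
    refine congrArg _ (Finset.sum_congr rfl fun k _ => ?_)
    rw [star_sub, star_mul, star_mul, star_star, star_star]
  · rw [perturbedInner_self x subset_rfl]
    exact add_nonneg (sub_nonneg.2 (hd _ _))
      (Finset.sum_nonneg fun k _ => mul_star_self_nonneg _)

/-- For a maximal Bessel family, functionals for the perturbed pairing are determined on `L`
by their values over the set on which the family vanishes. -/
theorem eq_zero_of_maximal_family [SMul A (K →₀ L)]
    (hs : ∀ (a : A) (w : K →₀ L) k, (a • w) k = a • w k) (hB : IsSemiInner A B) {R : Set L}
    (hR : 0 ∈ R) (hdA : ∀ k (a : A) x, d k (a • x) = a * d k x)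
    (hd : ∀ (F : Finset K) x, ∑ k ∈ F, d k x * star (d k x) ≤ B x x)
    (hmax : ∀ δ : L →ₗ[ℂ] A, (∀ (a : A) x, δ (a • x) = a * δ x) → (∀ y ∈ R, δ y = 0) →
      (∀ (F : Finset K) x, δ x * star (δ x) + ∑ k ∈ F, d k x * star (d k x) ≤ B x x) → δ = 0)
    {δ : L × (K →₀ L) →ₗ[ℂ] A} (hδA : ∀ (a : A) p, δ (a • p) = a * δ p) {C : ℝ}
    (hδb : ∀ p, ‖δ p‖ ≤ C * semiNorm (perturbedInner B d) p)
    (hδ : ∀ y ∈ R, ∀ w, δ (y, w) = 0) (x : L) : δ (x, 0) = 0 := by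
  classical
  set C' : ℝ := max C 1
  have hC' : 0 < C' := lt_max_of_lt_right one_pos
  have hmk : ∀ (a : A) (x : L), ((a • x, 0) : L × (K →₀ L)) = a • ((x, 0) : L × (K →₀ L)) :=
    fun a x => Prod.ext rfl (Finsupp.ext fun k => by
      rw [Prod.smul_snd, hs, Finsupp.zero_apply, hB.smulA_zero])
  have hA0 : ∀ (a : A) (x : L), δ (a • x, 0) = a * δ (x, 0) := fun a x => by
    rw [hmk, hδA]
  have hle : ∀ (F : Finset K) (x : L), δ (x, 0) * star (δ (x, 0)) ≤
      (C' ^ 2) • (B x x - ∑ k ∈ F, d k x * star (d k x)) := by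
    intro F
    refine mul_star_le_of_norm_sq_le (f := fun x => δ (x, 0)) hA0 (by positivity)
      (Q := fun x => B x x - ∑ k ∈ F, d k x * star (d k x))
      (fun x => sub_nonneg.2 (hd F x)) (fun a x => ?_) (fun x => ?_)
    · simp only [hB.smulA_left, hB.smulA_right, hdA, star_mul, mul_sub, sub_mul, Finset.mul_sum,
        Finset.sum_mul, mul_assoc]
    · let w : K →₀ L := Finsupp.onFinset F (fun k => if k ∈ F then -x else 0) fun k hk => by
        by_contra hkF
        exact hk (if_neg hkF)
      have hw : ∀ k ∈ F, w k = -x := fun k hk => by simp [w, hk]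
      have hws : w.support ⊆ F := Finsupp.support_onFinset_subset
      have e1 : δ (x, 0) = δ (x, w) := by
        have : ((x, w) : L × (K →₀ L)) = (x, 0) + (0, w) := by simp
        rw [this, map_add, hδ 0 hR, add_zero]
      have e2 : perturbedInner B d (x, w) (x, w) = B x x - ∑ k ∈ F, d k x * star (d k x) := by
        rw [perturbedInner_self _ hws, add_eq_left]
        refine Finset.sum_eq_zero fun k hk => ?_
        simp only [hw k hk, add_neg_cancel, map_zero, zero_mul]
      have e3 := hδb (x, w)
      rw [← e2, ← semiNorm_sq, ← mul_pow, e1]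
      refine pow_le_pow_left₀ (norm_nonneg _) (e3.trans ?_) 2
      exact mul_le_mul_of_nonneg_right (le_max_left _ _) (semiNorm_nonneg _ _)
  let δ' : L →ₗ[ℂ] A := ((C'⁻¹ : ℝ) : ℂ) • (δ ∘ₗ LinearMap.inl ℂ L (K →₀ L))
  have hδ' : ∀ x, δ' x = C'⁻¹ • δ (x, 0) := fun x => Complex.coe_smul _ _
  have h0 : δ' = 0 := by
    refine hmax δ' (fun a x => ?_) (fun y hy => ?_) fun F x => ?_
    · rw [hδ', hδ', hA0, mul_smul_comm]
    · rw [hδ', hδ y hy, smul_zero]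
    · rw [← le_sub_iff_add_le, hδ', star_smul, star_trivial, smul_mul_smul_comm]
      have := smul_le_smul_of_nonneg_left (hle F x) (by positivity : 0 ≤ C'⁻¹ * C'⁻¹)
      rw [smul_smul] at this
      have e : C'⁻¹ * C'⁻¹ * C' ^ 2 = 1 := by field_simp
      rwa [e, one_smul] at this
  have h1 := hδ' x
  rw [h0, LinearMap.zero_apply] at h1
  exact (smul_eq_zero.1 h1.symm).resolve_left (inv_ne_zero hC'.ne')

end Perturbation

section Projection

variable {A : Type u} [NonUnitalCStarAlgebra A] [PartialOrder A] [StarOrderedRing A]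

/-- A reflexive Hilbert module embedded bicontinuously into a semi-inner product module `L`
has orthogonal projections of the elements of `L`. -/
theorem IsCReflexive.exists_projection (hext : ExtensionProperty.{u, v} A)
    {M : Type v} [NormedAddCommGroup M] [NormedSpace ℂ M] [SMul A M] [HilbertCStarModule A M]
    (hrefl : IsCReflexive A (M := M)) {L : Type v} [AddCommGroup L] [Module ℂ L] [SMul A L]
    {B : L → L → A} (hB : IsSemiInner A B) (ι : M →ₗ[ℂ] L)
    (hιA : ∀ (a : A) x, ι (a • x) = a • ι x) {c C : ℝ} (hc : 0 < c)
    (hιc : ∀ x, c * ‖x‖ ≤ semiNorm B (ι x)) (hιC : ∀ x, semiNorm B (ι x) ≤ C * ‖x‖) (z : L) :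
    ∃ y : M, ∀ x : M, B (z - ι y) (ι x) = 0 := by
  obtain ⟨K, d, hdA, hdR, hd, hmax⟩ := hB.exists_maximal_family (Set.range ι)
  let _ : SMul A (K →₀ L) := ⟨fun a w => w.mapRange (a • ·) (hB.smulA_zero a)⟩
  have hs : ∀ (a : A) (w : K →₀ L) k, (a • w) k = a • w k :=
    fun a w k => Finsupp.mapRange_apply
  have hB₀ : IsSemiInner A (perturbedInner B d) := hB.perturbedInner hs hdA hd
  have hR0 : (0 : L) ∈ Set.range ι := ⟨0, map_zero ι⟩
  let e : M × (K →₀ L) →ₗ[ℂ] L × (K →₀ L) := ι.prodMap LinearMap.id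
  have heA : ∀ (a : A) p, e (a • p) = a • e p := fun a p => Prod.ext (hιA a p.1) rfl
  let IsExt : (M → A) → (L × (K →₀ L) →ₗ[ℂ] A) → Prop := fun r g =>
    (∀ (a : A) p, g (a • p) = a * g p) ∧
      (∃ C, ∀ p, ‖g p‖ ≤ C * semiNorm (perturbedInner B d) p) ∧ ∀ p, g (e p) = r p.1
  have huniq : ∀ r g g', IsExt r g → IsExt r g' → g (z, 0) = g' (z, 0) := by
    rintro r g g' ⟨hA, ⟨D, hb⟩, hr⟩ ⟨hA', ⟨D', hb'⟩, hr'⟩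
    rw [← sub_eq_zero, ← LinearMap.sub_apply]
    refine eq_zero_of_maximal_family hs hB hR0 hdA hd hmax (fun a p => ?_) (C := D + D')
      (fun p => ?_) ?_ z
    · rw [LinearMap.sub_apply, LinearMap.sub_apply, hA, hA', mul_sub]
    · rw [LinearMap.sub_apply, add_mul]
      exact (norm_sub_le _ _).trans (add_le_add (hb p) (hb' p))
    · rintro _ ⟨x, rfl⟩ w
      rw [LinearMap.sub_apply, sub_eq_zero]
      exact (hr (x, w)).trans (hr' (x, w)).symm
  have hB₀le : ∀ p : M × (K →₀ L), semiNorm B (ι p.1) ≤ semiNorm (perturbedInner B d) (e p) := by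
    intro p
    refine Real.sqrt_le_sqrt (CStarAlgebra.norm_le_norm_of_nonneg_of_le (hB.nonneg _) ?_)
    rw [perturbedInner_self _ subset_rfl]
    have h0 : ∑ k ∈ (e p).2.support, d k (e p).1 * star (d k (e p).1) = 0 :=
      Finset.sum_eq_zero fun k _ => by
        rw [show d k (e p).1 = 0 from hdR k _ ⟨p.1, rfl⟩, zero_mul]
    rw [h0, sub_zero]
    exact le_add_of_nonneg_right (Finset.sum_nonneg fun k _ => mul_star_self_nonneg _)
  have hexists : ∀ r : M → A, IsDualVector A r → ∃ g, IsExt r g ∧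
      ‖g (z, 0)‖ ≤ semiNorm (perturbedInner B d) (z, 0) / c * dualNorm A r := by
    intro r hr
    let f : M × (K →₀ L) →ₗ[ℂ] A :=
      { toFun := fun p => r p.1
        map_add' := fun p q => hr.map_add p.1 q.1
        map_smul' := fun a p => hr.map_smulC a p.1 }
    obtain ⟨g, hgA, hgb, hge⟩ := hext.exists_extension hB₀ e heA f
      (fun a p => hr.map_smulA a p.1) (C := dualNorm A r / c)
      (div_nonneg (dualNorm_nonneg r) hc.le) (fun p => by
        have h1 : c * ‖p.1‖ ≤ semiNorm (perturbedInner B d) (e p) :=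
          (hιc p.1).trans (hB₀le p)
        have h2 : ‖p.1‖ ≤ semiNorm (perturbedInner B d) (e p) / c := by
          rwa [le_div_iff₀' hc]
        refine (hr.norm_le p.1).trans ?_
        rw [div_mul_eq_mul_div, mul_div_assoc]
        exact mul_le_mul_of_nonneg_left h2 (dualNorm_nonneg r))
    refine ⟨g, ⟨hgA, ⟨_, hgb⟩, hge⟩, (hgb (z, 0)).trans (le_of_eq ?_)⟩
    ring
  classical
  choose! g hg hgb using hexists
  let F : (M → A) → A := fun r => g r (z, 0)
  have hF : IsBidualVector A F := by
    refine ⟨fun r s hr hs' => ?_, fun a r hr => ?_, fun a r hr => ?_, ⟨_, hgb⟩⟩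
    · have hrs : IsDualVector A fun x => r x + s x := by
        obtain ⟨D, hD⟩ := hr.bound
        obtain ⟨D', hD'⟩ := hs'.bound
        refine ⟨fun x y => ?_, fun a x => ?_, fun a x => ?_, ⟨D + D', fun x => ?_⟩⟩
        · rw [hr.map_add, hs'.map_add, add_add_add_comm]
        · rw [hr.map_smulC, hs'.map_smulC, smul_add]
        · rw [hr.map_smulA, hs'.map_smulA, mul_add]
        · rw [add_mul]
          exact (norm_add_le _ _).trans (add_le_add (hD x) (hD' x))
      refine huniq (fun x => r x + s x) _ (g r + g s) (hg _ hrs) ?_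
      obtain ⟨hA, ⟨D, hb⟩, hr'⟩ := hg r hr
      obtain ⟨hA', ⟨D', hb'⟩, hs''⟩ := hg s hs'
      refine ⟨fun a p => ?_, ⟨D + D', fun p => ?_⟩, fun p => ?_⟩
      · rw [LinearMap.add_apply, LinearMap.add_apply, hA, hA', mul_add]
      · rw [LinearMap.add_apply, add_mul]
        exact (norm_add_le _ _).trans (add_le_add (hb p) (hb' p))
      · rw [LinearMap.add_apply, hr', hs'']
    · have har : IsDualVector A fun x => a • r x := by
        obtain ⟨D, hD⟩ := hr.bound
        refine ⟨fun x y => ?_, fun b x => ?_, fun b x => ?_, ⟨‖a‖ * D, fun x => ?_⟩⟩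
        · rw [hr.map_add, smul_add]
        · rw [hr.map_smulC, smul_comm]
        · rw [hr.map_smulA, mul_smul_comm]
        · rw [norm_smul, mul_assoc]
          exact mul_le_mul_of_nonneg_left (hD x) (norm_nonneg a)
      refine huniq (fun x => a • r x) _ (a • g r) (hg _ har) ?_
      obtain ⟨hA, ⟨D, hb⟩, hr'⟩ := hg r hr
      refine ⟨fun b p => ?_, ⟨‖a‖ * D, fun p => ?_⟩, fun p => ?_⟩
      · rw [LinearMap.smul_apply, LinearMap.smul_apply, hA, mul_smul_comm]
      · rw [LinearMap.smul_apply, norm_smul, mul_assoc]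
        exact mul_le_mul_of_nonneg_left (hb p) (norm_nonneg a)
      · rw [LinearMap.smul_apply, hr']
    · have har : IsDualVector A fun x => r x * star a := by
        obtain ⟨D, hD⟩ := hr.bound
        refine ⟨fun x y => ?_, fun b x => ?_, fun b x => ?_, ⟨‖a‖ * D, fun x => ?_⟩⟩
        · rw [hr.map_add, add_mul]
        · rw [hr.map_smulC, smul_mul_assoc]
        · rw [hr.map_smulA, mul_assoc]
        · refine (norm_mul_le _ _).trans ?_
          rw [norm_star, mul_comm, mul_assoc]
          exact mul_le_mul_of_nonneg_left (hD x) (norm_nonneg a)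
      refine huniq (fun x => r x * star a) _ (LinearMap.mulRight ℂ (star a) ∘ₗ g r) (hg _ har) ?_
      obtain ⟨hA, ⟨D, hb⟩, hr'⟩ := hg r hr
      refine ⟨fun b p => ?_, ⟨‖a‖ * D, fun p => ?_⟩, fun p => ?_⟩
      · simp only [LinearMap.comp_apply, LinearMap.mulRight_apply, hA, mul_assoc]
      · rw [LinearMap.comp_apply, LinearMap.mulRight_apply]
        refine (norm_mul_le _ _).trans ?_
        rw [norm_star, mul_comm, mul_assoc]
        exact mul_le_mul_of_nonneg_left (hb p) (norm_nonneg a)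
      · rw [LinearMap.comp_apply, LinearMap.mulRight_apply, hr']
  obtain ⟨y, hy⟩ := hrefl F hF
  refine ⟨y, fun x => ?_⟩
  have hr : IsDualVector A fun u => B (ι u) (ι x) := by
    refine ⟨fun u v => ?_, fun a u => ?_, fun a u => ?_,
      ⟨C * semiNorm B (ι x), fun u => (hB.norm_le _ _).trans ?_⟩⟩
    · rw [map_add, hB.add_left]
    · rw [map_smul, hB.smulC_left]
    · rw [hιA, hB.smulA_left]
    · rw [mul_right_comm]
      exact mul_le_mul_of_nonneg_right (hιC u) (semiNorm_nonneg _ _)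
  have hext' : IsExt (fun u => B (ι u) (ι x))
      { toFun := fun p => perturbedInner B d p (ι x, 0)
        map_add' := fun p q => hB₀.add_left _ _ _
        map_smul' := fun a p => hB₀.smulC_left _ _ _ } := by
    refine ⟨fun a p => hB₀.smulA_left _ _ _,
      ⟨semiNorm (perturbedInner B d) (ι x, 0), fun p => ?_⟩, fun p => ?_⟩
    · rw [mul_comm]
      exact hB₀.norm_le p (ι x, 0)
    · change perturbedInner B d (ι p.1, p.2) (ι x, 0) = B (ι p.1) (ι x)
      rw [perturbedInner_eq (F := p.2.support) _ _ subset_rfl (by simp), add_eq_left]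
      refine Finset.sum_eq_zero fun k _ => ?_
      simp [hdR k (ι x) ⟨x, rfl⟩]
  have h1 := huniq _ _ _ (hg _ hr) hext'
  have h2 : perturbedInner B d (z, 0) (ι x, 0) = B (ι y) (ι x) := h1.symm.trans (hy _ hr)
  rw [perturbedInner_mk_zero] at h2
  rw [hB.sub_left, h2, sub_self]

end Projection

section Adjoint

open Filter Topology

variable {A : Type u} [NonUnitalCStarAlgebra A] [PartialOrder A] [StarOrderedRing A]
  {M : Type v} [NormedAddCommGroup M] [NormedSpace ℂ M] [SMul A M] [HilbertCStarModule A M]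

variable (A) in
theorem norm_hInner_le (x y : M) : ‖hInner A x y‖ ≤ ‖x‖ * ‖y‖ := by
  simpa only [semiNorm_hInner] using (isSemiInner_hInner (A := A) M).norm_le x y

variable (A) in
theorem eq_of_forall_hInner_eq {x y : M} (h : ∀ u : M, hInner A x u = hInner A y u) : x = y := by
  rw [← sub_eq_zero, ← HilbertCStarModule.inner_self_eq_zero (A := A)]
  change hInner A (x - y) (x - y) = 0
  rw [(isSemiInner_hInner (A := A) M).sub_left, h, sub_self]

variable (A) in
theorem continuous_hInner_left (u : M) : Continuous fun x : M => hInner A x u := by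
  have hM := isSemiInner_hInner (A := A) M
  have : LipschitzWith ⟨‖u‖, norm_nonneg u⟩ fun x : M => hInner A x u := by
    refine LipschitzWith.of_dist_le_mul fun x y => ?_
    rw [dist_eq_norm, dist_eq_norm, ← hM.sub_left]
    exact (norm_hInner_le A _ _).trans (mul_comm _ _).le
  exact this.continuous

/-- A vector representing `⟨y, T ·⟩` is bounded by the norm of `y`. -/
theorem norm_le_of_represents {T : M → M} {C : ℝ} (hT : ∀ x, ‖T x‖ ≤ C * ‖x‖) {s y : M}
    (hs : ∀ u, hInner A s u = hInner A y (T u)) : ‖s‖ ≤ C * ‖y‖ := by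
  rcases (norm_nonneg s).eq_or_lt with h0 | h0
  · rw [← h0]
    have h1 := (norm_nonneg _).trans (hT y)
    exact h1
  · have h1 : ‖s‖ ^ 2 = ‖hInner A s s‖ := by
      rw [← semiNorm_sq, semiNorm_hInner]
    rw [hs] at h1
    have h2 := norm_hInner_le A y (T s)
    have h3 := mul_le_mul_of_nonneg_left (hT s) (norm_nonneg y)
    refine le_of_mul_le_mul_right ?_ h0
    nlinarith

/-- The vectors `y` for which `⟨y, T ·⟩` is represented by a vector form a closed subspace. -/
def representedSubmodule (A : Type u) [NonUnitalCStarAlgebra A] [PartialOrder A]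
    [StarOrderedRing A] {M : Type v} [NormedAddCommGroup M] [NormedSpace ℂ M] [SMul A M]
    [HilbertCStarModule A M] (T : M → M) : Submodule ℂ M where
  carrier := {y | ∃ s, ∀ u, hInner A s u = hInner A y (T u)}
  add_mem' := by
    have hM := isSemiInner_hInner (A := A) M
    rintro x y ⟨s, hs⟩ ⟨t, ht⟩
    exact ⟨s + t, fun u => by rw [hM.add_left, hM.add_left, hs, ht]⟩
  zero_mem' := ⟨0, fun u => by
    have hM := isSemiInner_hInner (A := A) M
    rw [hM.zero_left, hM.zero_left]⟩
  smul_mem' := by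
    have hM := isSemiInner_hInner (A := A) M
    rintro c x ⟨s, hs⟩
    exact ⟨c • s, fun u => by rw [hM.smulC_left, hM.smulC_left, hs]⟩

theorem isClosed_representedSubmodule {T : M → M} {C : ℝ} (hT : ∀ x, ‖T x‖ ≤ C * ‖x‖) :
    IsClosed (representedSubmodule A T : Set M) := by
  have hM := isSemiInner_hInner (A := A) M
  have : CompleteSpace M := HilbertCStarModule.complete A
  refine isClosed_of_closure_subset fun y hy => ?_
  obtain ⟨x, hx, hlim⟩ := mem_closure_iff_seq_limit.1 hy
  choose s hs using hx
  have hcauchy : CauchySeq s := by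
    rw [cauchySeq_iff_tendsto_dist_atTop_0]
    have h1 := (cauchySeq_iff_tendsto_dist_atTop_0.1 hlim.cauchySeq).const_mul C
    rw [mul_zero] at h1
    refine squeeze_zero (fun _ => dist_nonneg) (fun p => ?_) h1
    rw [dist_eq_norm, dist_eq_norm]
    refine norm_le_of_represents (A := A) hT fun u => ?_
    rw [hM.sub_left, hM.sub_left, hs, hs]
  obtain ⟨t, ht⟩ := cauchySeq_tendsto_of_complete hcauchy
  refine ⟨t, fun u => tendsto_nhds_unique
    (((continuous_hInner_left A u).tendsto t).comp ht) ?_⟩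
  have h2 := ((continuous_hInner_left A (T u)).tendsto y).comp hlim
  refine h2.congr fun n => ?_
  exact (hs n u).symm

/-- The pairing `⟨a, c⟩ + κ ⟨b, d⟩` on `M × M`. -/
theorem isSemiInner_prod {κ : ℝ} (hκ : 0 ≤ κ) :
    IsSemiInner A fun p q : M × M => hInner A p.1 q.1 + κ • hInner A p.2 q.2 := by
  have hM := isSemiInner_hInner (A := A) M
  refine ⟨fun a x y => ?_, fun a b x => ?_, fun a b x => ?_, fun a b x => ?_, fun x y z => ?_,
    fun a x y => ?_, fun c x y => ?_, fun x y => ?_, fun x => ?_⟩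
  · exact Prod.ext (hM.smul_add' _ _ _) (hM.smul_add' _ _ _)
  · exact Prod.ext (hM.add_smul' _ _ _) (hM.add_smul' _ _ _)
  · exact Prod.ext (hM.mul_smul' _ _ _) (hM.mul_smul' _ _ _)
  · exact Prod.ext (hM.smul_smul' _ _ _) (hM.smul_smul' _ _ _)
  · simp only [Prod.fst_add, Prod.snd_add, hM.add_left, smul_add]
    abel
  · simp only [Prod.smul_fst, Prod.smul_snd, hM.smulA_left, mul_add, mul_smul_comm]
  · simp only [Prod.smul_fst, Prod.smul_snd, hM.smulC_left, smul_add]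
    rw [smul_comm]
  · simp only [star_add, star_smul, star_trivial κ]
    rw [← hM.conj, ← hM.conj]
  · exact add_nonneg (hM.nonneg _) (smul_nonneg hκ (hM.nonneg _))

/-- Every bounded module map on a reflexive Hilbert module is adjointable at each vector. -/
theorem IsCReflexive.exists_represents (hext : ExtensionProperty.{u, v} A)
    (hrefl : IsCReflexive A (M := M)) {T : M → M} (hT : IsBoundedModuleMap A T) (y : M) :
    ∃ s, ∀ u, hInner A s u = hInner A y (T u) := by
  have hM := isSemiInner_hInner (A := A) M
  obtain ⟨C, hC0, hC⟩ : ∃ C : ℝ, 0 < C ∧ ∀ x, ‖T x‖ ≤ C * ‖x‖ := by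
    obtain ⟨C, hC⟩ := hT.bound
    exact ⟨max C 1, lt_max_of_lt_right one_pos, fun x => (hC x).trans
      (mul_le_mul_of_nonneg_right (le_max_left _ _) (norm_nonneg x))⟩
  set κ : ℝ := (4 * C ^ 2)⁻¹ with hκ
  have hκ0 : 0 < κ := by positivity
  have hκC : κ * C ^ 2 = 1 / 4 := by rw [hκ]; field_simp
  have hB := isSemiInner_prod (A := A) (M := M) hκ0.le
  let ι : M →ₗ[ℂ] M × M :=
    { toFun := fun x => (x, T x)
      map_add' := fun x x' => Prod.ext rfl (hT.map_add x x')
      map_smul' := fun c x => Prod.ext rfl (hT.map_smulC c x) }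
  have hproj := IsCReflexive.exists_projection hext hrefl hB ι
    (fun a x => Prod.ext rfl (hT.map_smulA a x)) (c := 1) (C := 2) one_pos (fun x => ?_)
    (fun x => ?_)
  · change y ∈ representedSubmodule A T
    by_contra hy
    obtain ⟨x₀, hx₀, hdist⟩ := riesz_lemma (isClosed_representedSubmodule (A := A) hC) ⟨y, hy⟩
      (show (1 / 2 : ℝ) < 1 by norm_num)
    obtain ⟨x, hx⟩ := hproj (0, x₀)
    have hx' : ∀ u, hInner A x u = κ • hInner A (x₀ - T x) (T u) := fun u => by
      have h1 : hInner A (0 - x) u + κ • hInner A (x₀ - T x) (T u) = 0 := hx u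
      rw [hM.sub_left, hM.zero_left, zero_sub] at h1
      exact (neg_add_eq_zero.1 h1)
    have hmem : x₀ - T x ∈ representedSubmodule A T := by
      refine ⟨((κ⁻¹ : ℝ) : ℂ) • x, fun u => ?_⟩
      rw [hM.smulC_left, hx', Complex.coe_smul, inv_smul_smul₀ hκ0.ne']
    have h2 := hdist _ hmem
    rw [sub_sub_cancel] at h2
    have hx₀0 : 0 < ‖x₀‖ := norm_pos_iff.2 fun h => hx₀ (h ▸ zero_mem _)
    have h3 : ‖x‖ ^ 2 ≤ κ * ((‖x₀‖ + C * ‖x‖) * (C * ‖x‖)) := by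
      have e : ‖x‖ ^ 2 = ‖hInner A x x‖ := by rw [← semiNorm_sq, semiNorm_hInner]
      rw [e, hx', norm_smul, Real.norm_of_nonneg hκ0.le]
      have h4 := (norm_hInner_le A (x₀ - T x) (T x))
      have h5 : ‖x₀ - T x‖ ≤ ‖x₀‖ + C * ‖x‖ :=
        (norm_sub_le _ _).trans (add_le_add le_rfl (hC x))
      gcongr
      exact h4.trans (mul_le_mul h5 (hC x) (norm_nonneg _) (by positivity))
    have h6 : C * ‖x‖ < 1 / 2 * ‖x₀‖ := by
      by_contra hcon
      push Not at hcon
      have hxpos : 0 < C * ‖x‖ := lt_of_lt_of_le (by positivity) hcon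
      have h7 : (C * ‖x‖) ^ 2 ≤ 1 / 4 * ((‖x₀‖ + C * ‖x‖) * (C * ‖x‖)) := by
        have := mul_le_mul_of_nonneg_left h3 (sq_nonneg C)
        rw [← mul_assoc, mul_comm (C ^ 2) κ, hκC] at this
        rwa [mul_pow]
      nlinarith
    linarith [hC x]
  · rw [one_mul, ← semiNorm_hInner (A := A)]
    refine Real.sqrt_le_sqrt (CStarAlgebra.norm_le_norm_of_nonneg_of_le (hM.nonneg _) ?_)
    exact le_add_of_nonneg_right (smul_nonneg hκ0.le (hM.nonneg _))
  · refine Real.sqrt_le_iff.2 ⟨by positivity, ?_⟩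
    refine (norm_add_le _ _).trans ?_
    rw [norm_smul, Real.norm_of_nonneg hκ0.le, ← semiNorm_sq, ← semiNorm_sq, semiNorm_hInner,
      semiNorm_hInner]
    change ‖x‖ ^ 2 + κ * ‖T x‖ ^ 2 ≤ (2 * ‖x‖) ^ 2
    have h1 : ‖T x‖ ^ 2 ≤ (C * ‖x‖) ^ 2 := pow_le_pow_left₀ (norm_nonneg _) (hC x) 2
    have h2 := mul_le_mul_of_nonneg_left h1 hκ0.le
    rw [mul_pow, ← mul_assoc, hκC] at h2
    nlinarith [sq_nonneg ‖x‖]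

end Adjoint

/-- STATEMENT 16: Over a C*-algebra with the extension property, every `A`-reflexive Hilbert
`A`-module is orthogonally complementary, and every bounded `A`-linear operator on it is
adjointable. -/
theorem reflexive_orthogonally_complementary_and_adjointable
    (A : Type u) [NonUnitalCStarAlgebra A]
    (hext : ExtensionProperty.{u, v} A)
    (M : Type v) [NormedAddCommGroup M] [NormedSpace ℂ M] [SMul A M] [HilbertCStarModule A M]
    (hrefl : IsCReflexive A (M := M)) :
    (∀ (L : Type v) [NormedAddCommGroup L] [NormedSpace ℂ L] [SMul A L]
        [HilbertCStarModule A L] (ι : M → L),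
      IsBoundedModuleMap A ι → Function.Injective ι → IsClosed (Set.range ι) →
      (∃ c : ℝ, 0 < c ∧ ∀ x : M, c * ‖x‖ ≤ ‖ι x‖) →
      ∀ z : L, ∃ (x : M) (w : L), w ∈ orthComp A (Set.range ι) ∧ z = ι x + w) ∧
    (∀ T : M → M, IsBoundedModuleMap A T →
      ∃ S : M → M, IsBoundedModuleMap A S ∧
        ∀ x y : M, hInner A (T x) y = hInner A x (S y)) := by
  let _ := CStarAlgebra.spectralOrder A
  have _ := CStarAlgebra.spectralOrderedRing A
  have hM := isSemiInner_hInner (A := A) M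
  refine ⟨fun L _ _ _ _ ι hι _ _ ⟨c, hc, hιc⟩ z => ?_, fun T hT => ?_⟩
  · obtain ⟨C, hC⟩ := hι.bound
    obtain ⟨x, hx⟩ := IsCReflexive.exists_projection hext hrefl (isSemiInner_hInner (A := A) L)
      { toFun := ι, map_add' := hι.map_add, map_smul' := hι.map_smulC } hι.map_smulA hc
      (fun x => by rw [semiNorm_hInner]; exact hιc x)
      (fun x => by rw [semiNorm_hInner]; exact hC x) z
    refine ⟨x, z - ι x, ?_, (add_sub_cancel _ _).symm⟩
    rintro _ ⟨u, rfl⟩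
    exact hx u
  · choose S hS using IsCReflexive.exists_represents hext hrefl hT
    obtain ⟨C, hC⟩ := hT.bound
    refine ⟨S, ⟨fun x y => ?_, fun c x => ?_, fun a x => ?_,
      ⟨C, fun y => norm_le_of_represents (A := A) hC (hS y)⟩⟩, fun x y => ?_⟩
    · refine eq_of_forall_hInner_eq A fun u => ?_
      rw [hS, hM.add_left, hM.add_left, hS, hS]
    · refine eq_of_forall_hInner_eq A fun u => ?_
      rw [hS, hM.smulC_left, hM.smulC_left, hS]
    · refine eq_of_forall_hInner_eq A fun u => ?_
      rw [hS, hM.smulA_left, hM.smulA_left, hS]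
    · rw [hM.conj, ← hS, ← hM.conj]
end
end

section
/- Let A = C([0,1]) be the C*-algebra of continuous complex-valued functions on [0,1], and let I = C₀((0,1]) = {f ∈ A : f(0) = 0}, a Hilbert A-module with inner product ⟨f,g⟩ = f·ḡ. Define r : I → I ⊆ A by r(f)(t) = sin(1/t)·f(t) for t ∈ (0,1] and r(f)(0) = 0. Then r is a well-defined bounded A-linear map on I, but there exists no bounded A-linear map r' : A → A with r'(f) = r(f) for all f ∈ I. -/
noncomputable section

open scoped ENNReal MultiplierAlgebra

universe u v w

/-- Every C*-algebra is a Hilbert C*-module over itself with `⟨x, y⟩ = x * (star y)`. -/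
instance selfHilbertCStarModule (A : Type u) [NonUnitalCStarAlgebra A] :
    HilbertCStarModule A A where
  inner x y := x * star y
  smul_add' a x y := mul_add a x y
  add_smul' a b x := add_mul a b x
  mul_smul' a b x := mul_assoc a b x
  smul_smul' c a x := smul_mul_assoc c a x
  inner_add_left x y z := add_mul x y (star z)
  inner_smulA_left a x y := mul_assoc a x (star y)
  inner_smulC_left c x y := smul_mul_assoc c x (star y)
  inner_conj x y := by simp [star_mul]
  inner_self_pos x := ⟨star x, by rw [star_star]⟩
  inner_self_eq_zero x := CStarRing.mul_star_self_eq_zero_iff x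
  norm_eq x := by
    rw [CStarRing.norm_self_mul_star]
    exact (Real.sqrt_mul_self (norm_nonneg x)).symm
  complete := inferInstance

/-- The C*-algebra `C([0,1], ℂ)`. -/
abbrev CUnitInterval : Type := C(Set.Icc (0:ℝ) 1, ℂ)

/-- The point `0` of the unit interval. -/
def zeroPt : Set.Icc (0:ℝ) 1 := ⟨0, by norm_num⟩

/-- Multiplying a continuous function by a bounded function which is continuous away from a zero
of the former yields a continuous function. -/
theorem continuous_mul_of_bounded_of_continuousAt {X R : Type*} [TopologicalSpace X]
    [NonUnitalSeminormedRing R] {g f : X → R} {x₀ : X} {C : ℝ} (hg : ∀ x, ‖g x‖ ≤ C)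
    (hgc : ∀ x, x ≠ x₀ → ContinuousAt g x) (hf : Continuous f) (h₀ : f x₀ = 0) :
    Continuous fun x => g x * f x := by
  refine continuous_iff_continuousAt.2 fun x => ?_
  rcases eq_or_ne x x₀ with rfl | hx
  · have hfx : Filter.Tendsto f (nhds x) (nhds 0) := h₀ ▸ hf.tendsto x
    have hbdd : Filter.IsBoundedUnder (· ≤ ·) (nhds x) ((‖·‖) ∘ g) :=
      Filter.isBoundedUnder_of ⟨C, hg⟩
    simpa [ContinuousAt, h₀] using Filter.isBoundedUnder_le_mul_tendsto_zero hbdd hfx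
  · exact (hgc x hx).mul hf.continuousAt

/-- The function `t ↦ sin (1 / t)` on the unit interval; its value at `0` is `0`. -/
def sinOneDiv (t : Set.Icc (0:ℝ) 1) : ℂ := (Real.sin (1 / (t : ℝ)) : ℂ)

theorem norm_sinOneDiv_le (t : Set.Icc (0:ℝ) 1) : ‖sinOneDiv t‖ ≤ 1 := by
  rw [sinOneDiv, Complex.norm_real]
  exact Real.abs_sin_le_one _

theorem continuousAt_sinOneDiv {t : Set.Icc (0:ℝ) 1} (ht : t ≠ zeroPt) :
    ContinuousAt sinOneDiv t := by
  have ht' : (t : ℝ) ≠ 0 := fun h => ht (Subtype.ext h)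
  unfold sinOneDiv
  exact Complex.continuous_ofReal.continuousAt.comp (Real.continuous_sin.continuousAt.comp
    (continuousAt_const.div continuous_subtype_val.continuousAt ht'))

/-- `t ↦ sin (1 / t)` has no continuous extension to the unit interval. -/
theorem not_forall_eq_sinOneDiv (h : CUnitInterval) :
    ¬∀ t : Set.Icc (0:ℝ) 1, t ≠ zeroPt → h t = sinOneDiv t := by
  intro hh
  have value_at_zero (a : ℝ) (ha : 1 ≤ a) : h zeroPt = (Real.sin a : ℂ) := by
    have hpos (n : ℕ) : 1 ≤ a + n * (2 * Real.pi) :=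
      ha.trans (le_add_of_nonneg_right (by positivity))
    let s (n : ℕ) : Set.Icc (0:ℝ) 1 :=
      ⟨(a + n * (2 * Real.pi))⁻¹, inv_nonneg.2 (zero_le_one.trans (hpos n)),
        inv_le_one_of_one_le₀ (hpos n)⟩
    have hs : Filter.Tendsto s Filter.atTop (nhds zeroPt) := by
      refine tendsto_subtype_rng.2 (tendsto_inv_atTop_zero.comp ?_)
      exact Filter.tendsto_atTop_add_const_left _ _
        (tendsto_natCast_atTop_atTop.atTop_mul_const Real.two_pi_pos)
    refine tendsto_nhds_unique ((h.continuous.tendsto zeroPt).comp hs) ?_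
    refine tendsto_const_nhds.congr fun n => ?_
    have hsn : s n ≠ zeroPt := fun H =>
      (inv_pos.2 (zero_lt_one.trans_le (hpos n))).ne' (congrArg Subtype.val H)
    rw [Function.comp_apply, hh _ hsn, sinOneDiv, one_div, inv_inv, Real.sin_add_nat_mul_two_pi]
  have h1 := value_at_zero Real.pi (by linarith [Real.pi_gt_three])
  have h2 := value_at_zero (Real.pi / 2) (by linarith [Real.pi_gt_three])
  rw [Real.sin_pi] at h1
  rw [Real.sin_pi_div_two, h1] at h2
  norm_num at h2

open Classical in
/-- The multiplication operator by `sin (1 / t)` on the functions vanishing at `0`, extended by `0`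
to the other functions. -/
def sinOneDivMul (f : CUnitInterval) : CUnitInterval :=
  if hf : f zeroPt = 0 then
    ⟨fun t => sinOneDiv t * f t, continuous_mul_of_bounded_of_continuousAt norm_sinOneDiv_le
      (fun _ => continuousAt_sinOneDiv) f.continuous hf⟩
  else 0

theorem sinOneDivMul_apply {f : CUnitInterval} (hf : f zeroPt = 0) (t : Set.Icc (0:ℝ) 1) :
    sinOneDivMul f t = sinOneDiv t * f t := by
  rw [sinOneDivMul, dif_pos hf]
  rfl

theorem isDualVectorOn_sinOneDivMul :
    IsDualVectorOn CUnitInterval {f : CUnitInterval | f zeroPt = 0} sinOneDivMul where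
  map_add x (hx : x zeroPt = 0) y (hy : y zeroPt = 0) := by
    ext t
    have hxy : (x + y) zeroPt = 0 := by simp [hx, hy]
    simp [sinOneDivMul_apply, hx, hy, hxy, mul_add]
  map_smulC c x (hx : x zeroPt = 0) := by
    ext t
    have hcx : (c • x) zeroPt = 0 := by simp [hx]
    simp [sinOneDivMul_apply, hx, hcx, mul_left_comm]
  map_smulA a x (hx : x zeroPt = 0) := by
    ext t
    have hax : (a • x) zeroPt = 0 := by simp [hx]
    rw [ContinuousMap.mul_apply, sinOneDivMul_apply hx, sinOneDivMul_apply hax]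
    simp [mul_left_comm]
  bound := ⟨1, fun x (hx : x zeroPt = 0) => by
    rw [one_mul, ContinuousMap.norm_le _ (norm_nonneg x)]
    intro t
    rw [sinOneDivMul_apply hx, norm_mul]
    exact (mul_le_of_le_one_left (norm_nonneg _) (norm_sinOneDiv_le t)).trans
      (x.norm_coe_le_norm t)⟩

/-- STATEMENT 18: For `A = C([0,1])` and the Hilbert `A`-module
`I = C₀((0,1]) = {f ∈ A : f 0 = 0}`, the map `r : I → I`,
`(r f)(t) = sin(1/t) · f(t)` (and `(r f)(0) = 0`), is a well-defined bounded `A`-linear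
map on `I` which admits no bounded `A`-linear extension `r' : A → A`. -/
theorem sin_one_div_multiplier_has_no_extension :
    letI A := CUnitInterval
    letI I : Set A := {f : A | f zeroPt = 0}
    ∃ r : A → A,
      (∀ f ∈ I, ∀ t : Set.Icc (0:ℝ) 1, (t : ℝ) ≠ 0 →
        r f t = (Real.sin (1 / (t : ℝ)) : ℂ) * f t) ∧
      (∀ f ∈ I, r f zeroPt = 0) ∧
      (∀ f ∈ I, r f ∈ I) ∧
      IsDualVectorOn A I r ∧
      ¬∃ r' : A → A, IsDualVector A r' ∧ ∀ f ∈ I, r' f = r f := by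
  have r_zero (f : CUnitInterval) (hf : f zeroPt = 0) : sinOneDivMul f zeroPt = 0 := by
    rw [sinOneDivMul_apply hf, hf, mul_zero]
  refine ⟨sinOneDivMul, fun f hf t _ => sinOneDivMul_apply hf t, r_zero, r_zero,
    isDualVectorOn_sinOneDivMul, ?_⟩
  rintro ⟨r', hr', hext⟩
  refine not_forall_eq_sinOneDiv (r' 1) fun t ht => ?_
  let coord : CUnitInterval := ⟨fun s => ((s : ℝ) : ℂ), by fun_prop⟩
  have hcoord : coord zeroPt = 0 := Complex.ofReal_zero
  have hne : coord t ≠ 0 := fun H => ht (Subtype.ext (Complex.ofReal_eq_zero.1 H))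
  have hmul : r' coord = coord * r' 1 := by
    rw [← hr'.map_smulA, smul_eq_mul, mul_one]
  have hval : coord t * r' 1 t = sinOneDiv t * coord t := by
    rw [← sinOneDivMul_apply hcoord, ← hext coord hcoord, hmul, ContinuousMap.mul_apply]
  exact mul_left_cancel₀ hne (hval.trans (mul_comm _ _))
end
end

section
/- Let A be a C*-algebra and M a full Hilbert A-module, i.e., the norm-closed linear span of {⟨x,y⟩ : x, y ∈ M} equals A. Then every bounded A-linear operator T : M → M possesses an adjoint bounded A-linear operator T* : M → M (with ⟨Tx, y⟩ = ⟨x, T*y⟩ for all x, y ∈ M) if and only if M is orthogonally complementary: for every Hilbert A-module L and every injective bounded A-linear map ι : M → L with norm-closed range and bounded inverse on its range, L = ι(M) ⊕ ι(M)^⊥ as an orthogonal direct sum. -/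
noncomputable section

open scoped ENNReal MultiplierAlgebra

universe u v w

namespace CStarModule

open Filter Topology
open scoped InnerProductSpace WithCStarModule

variable {A E F : Type*} [NonUnitalCStarAlgebra A] [PartialOrder A]
  [NormedAddCommGroup E] [NormedSpace ℂ E] [SMul A E] [CStarModule A E]
  [NormedAddCommGroup F] [NormedSpace ℂ F] [SMul A F] [CStarModule A F]

variable (A) in
theorem ext_inner {x y : E} (h : ∀ u : E, ⟪u, x⟫_A = ⟪u, y⟫_A) : x = y := by
  rw [← sub_eq_zero, ← inner_self (A := A), inner_sub_right, h, sub_self]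

theorem inner_comm_congr {x y : E} {u v : F} (h : ⟪x, y⟫_A = ⟪u, v⟫_A) : ⟪y, x⟫_A = ⟪v, u⟫_A := by
  rw [← star_inner, h, star_inner]

theorem op_smul_add (a : A) (x y : E) : a • (x + y) = a • x + a • y :=
  ext_inner A fun u => by simp [mul_add]

theorem add_op_smul (a b : A) (x : E) : (a + b) • x = a • x + b • x :=
  ext_inner A fun u => by simp [add_mul]

theorem mul_op_smul (a b : A) (x : E) : (a * b) • x = a • (b • x) :=
  ext_inner A fun u => by simp [mul_assoc]

theorem smul_op_smul (c : ℂ) (a : A) (x : E) : (c • a) • x = c • (a • x) :=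
  ext_inner A fun u => by simp [smul_mul_assoc]

theorem norm_op_smul_le (a : A) (x : E) : ‖a • x‖ ≤ ‖a‖ * ‖x‖ := by
  refine (sq_le_sq₀ (norm_nonneg _) (by positivity)).1 ?_
  calc ‖a • x‖ ^ 2 = ‖a * ⟪x, x⟫_A * star a‖ := by
        rw [norm_sq_eq A, inner_op_smul_right, inner_op_smul_left, mul_assoc]
    _ ≤ ‖a‖ * ‖⟪x, x⟫_A‖ * ‖star a‖ :=
        (norm_mul_le _ _).trans (by gcongr; exact norm_mul_le _ _)
    _ = (‖a‖ * ‖x‖) ^ 2 := by rw [norm_star, ← norm_sq_eq A]; ring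

variable [StarOrderedRing A]

theorem norm_le_of_inner_self_le {x : E} {y : F} (h : ⟪x, x⟫_A ≤ ⟪y, y⟫_A) : ‖x‖ ≤ ‖y‖ := by
  refine (sq_le_sq₀ (norm_nonneg _) (norm_nonneg _)).1 ?_
  rw [norm_sq_eq A, norm_sq_eq A]
  exact CStarAlgebra.norm_le_norm_of_nonneg_of_le inner_self_nonneg h

/-- The value `m` of the adjoint of `T` at `z`, if it exists, satisfies `‖m‖ ≤ ‖T‖ * ‖z‖`. -/
theorem norm_le_of_inner_eq (T : E →L[ℂ] F) {z : F} {m : E}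
    (h : ∀ u, ⟪T u, z⟫_A = ⟪u, m⟫_A) : ‖m‖ ≤ ‖T‖ * ‖z‖ := by
  rcases (norm_nonneg m).eq_or_lt with h0 | h0
  · rw [← h0]; positivity
  refine le_of_mul_le_mul_left ?_ h0
  calc ‖m‖ * ‖m‖ = ‖⟪T m, z⟫_A‖ := by rw [h, ← norm_sq_eq A, sq]
    _ ≤ ‖T m‖ * ‖z‖ := norm_inner_le F
    _ ≤ ‖T‖ * ‖m‖ * ‖z‖ := by gcongr; exact T.le_opNorm m
    _ = ‖m‖ * (‖T‖ * ‖z‖) := by ring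

theorem norm_apply_le_norm_add_smul_I {P : E →L[ℂ] E}
    (hP : ∀ x y, ⟪P x, y⟫_A = ⟪x, P y⟫_A) (t : ℝ) (x : E) :
    ‖P x‖ ≤ ‖(P + ((t : ℂ) * Complex.I) • (1 : E →L[ℂ] E)) x‖ := by
  refine norm_le_of_inner_self_le (A := A) ?_
  have key : ⟪(P + ((t : ℂ) * Complex.I) • (1 : E →L[ℂ] E)) x,
      (P + ((t : ℂ) * Complex.I) • (1 : E →L[ℂ] E)) x⟫_A
      = ⟪P x, P x⟫_A + ⟪((t : ℂ) * Complex.I) • x, ((t : ℂ) * Complex.I) • x⟫_A := by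
    simp [hP]
  rw [key]
  exact le_add_of_nonneg_right inner_self_nonneg

/-- The method of continuity along `P + i t`: a symmetric operator which is bounded below is
invertible. -/
theorem isUnit_of_symmetric [CompleteSpace E] [Nontrivial E] {P : E →L[ℂ] E}
    (hP : ∀ x y, ⟪P x, y⟫_A = ⟪x, P y⟫_A) {c : ℝ} (hc : 0 < c)
    (hbelow : ∀ x, c * ‖x‖ ≤ ‖P x‖) : IsUnit P := by
  let R : ℝ → (E →L[ℂ] E) := fun t => P + ((t : ℂ) * Complex.I) • (1 : E →L[ℂ] E)
  have step : ∀ s t : ℝ, IsUnit (R s) → ‖t - s‖ < c → IsUnit (R t) := by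
    rintro s t ⟨u, hu⟩ hst
    have hinv : ‖((u⁻¹ : (E →L[ℂ] E)ˣ) : E →L[ℂ] E)‖ ≤ c⁻¹ := by
      refine ContinuousLinearMap.opNorm_le_bound _ (by positivity) fun y => ?_
      set x := ((u⁻¹ : (E →L[ℂ] E)ˣ) : E →L[ℂ] E) y with hx
      have hy : R s x = y := by
        rw [← hu, hx, ← mul_apply_eq_comp, u.mul_inv]; rfl
      have := (hbelow x).trans (norm_apply_le_norm_add_smul_I hP s x)
      rw [show (P + ((s : ℂ) * Complex.I) • (1 : E →L[ℂ] E)) x = y from hy] at this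
      rwa [inv_mul_eq_div, le_div_iff₀' hc]
    have hd : R t - R s = (((t - s : ℝ) : ℂ) * Complex.I) • (1 : E →L[ℂ] E) := by
      simp only [R, Complex.ofReal_sub, sub_mul, sub_smul]; abel
    have hlt : ‖R t - R s‖ < ‖((u⁻¹ : (E →L[ℂ] E)ˣ) : E →L[ℂ] E)‖⁻¹ := by
      refine lt_of_lt_of_le ?_ (le_inv_of_le_inv₀ (Units.norm_pos _) hinv)
      rw [hd, norm_smul, norm_one, mul_one, norm_mul, Complex.norm_I, mul_one, Complex.norm_real]
      exact hst
    refine ⟨u.add (R t - R s) hlt, ?_⟩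
    rw [Units.val_add, hu]; abel
  have hclopen : IsClopen {t : ℝ | IsUnit (R t)} := by
    constructor
    · refine isClosed_of_closure_subset fun t ht => ?_
      obtain ⟨s, hs, hst⟩ := Metric.mem_closure_iff.1 ht c hc
      exact step s t hs (by rwa [← dist_eq_norm])
    · refine Metric.isOpen_iff.2 fun s hs => ⟨c, hc, fun t ht => step s t hs ?_⟩
      rwa [← dist_eq_norm]
  have hne : {t : ℝ | IsUnit (R t)}.Nonempty := by
    have h0 : (((‖P‖ + 1 : ℝ) : ℂ) * Complex.I) ≠ 0 := by
      refine mul_ne_zero (Complex.ofReal_ne_zero.2 (by positivity)) Complex.I_ne_zero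
    refine ⟨‖P‖ + 1, ?_⟩
    have hmem : -(((‖P‖ + 1 : ℝ) : ℂ) * Complex.I) ∈ resolventSet ℂ P := by
      refine spectrum.mem_resolventSet_of_norm_lt ?_
      rw [norm_neg, norm_mul, Complex.norm_I, mul_one, Complex.norm_real, Real.norm_eq_abs]
      exact (lt_add_one _).trans_le (le_abs_self _)
    rw [spectrum.mem_resolventSet_iff, ← IsUnit.neg_iff] at hmem
    simpa [R, Algebra.algebraMap_eq_smul_one, add_comm] using hmem
  have h0 : (0 : ℝ) ∈ {t : ℝ | IsUnit (R t)} := by rw [hclopen.eq_univ hne]; trivial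
  simpa [R] using h0

/-- A bounded symmetric self-map of a Hilbert C⋆-module which is bounded below is surjective. -/
theorem surjective_of_symmetric [CompleteSpace E] {P : E → E}
    (hP : ∀ x y, ⟪P x, y⟫_A = ⟪x, P y⟫_A) {C : ℝ} (hC : ∀ x, ‖P x‖ ≤ C * ‖x‖)
    {c : ℝ} (hc : 0 < c) (hbelow : ∀ x, c * ‖x‖ ≤ ‖P x‖) : Function.Surjective P := by
  rcases subsingleton_or_nontrivial E with h | h
  · exact fun y => ⟨y, Subsingleton.elim _ _⟩
  let Q : E →ₗ[ℂ] E :=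
    { toFun := P
      map_add' := fun x y => ext_inner A fun u => by simp [← hP]
      map_smul' := fun a x => ext_inner A fun u => by simp [← hP] }
  obtain ⟨u, hu⟩ := isUnit_of_symmetric (P := Q.mkContinuous C hC) hP hc hbelow
  intro y
  refine ⟨((u⁻¹ : (E →L[ℂ] E)ˣ) : E →L[ℂ] E) y, ?_⟩
  change Q.mkContinuous C hC _ = y
  rw [← hu, ← mul_apply_eq_comp, u.mul_inv]; rfl

variable (A) in
/-- The vectors at which a bounded operator between Hilbert C⋆-modules has an adjoint value. -/
def adjointDomain (T : E →L[ℂ] F) : Submodule ℂ F where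
  carrier := {z | ∃ m : E, ∀ u, ⟪T u, z⟫_A = ⟪u, m⟫_A}
  zero_mem' := ⟨0, by simp⟩
  add_mem' := by
    rintro z w ⟨m, hm⟩ ⟨n, hn⟩
    exact ⟨m + n, by simp [hm, hn]⟩
  smul_mem' := by
    rintro c z ⟨m, hm⟩
    exact ⟨c • m, by simp [hm]⟩

theorem isClosed_adjointDomain [CompleteSpace E] (T : E →L[ℂ] F) :
    IsClosed (adjointDomain A T : Set F) := by
  refine isClosed_of_closure_subset fun z hz => ?_
  obtain ⟨s, hs, hsz⟩ := mem_closure_iff_seq_limit.1 hz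
  choose m hm using hs
  have hcauchy : CauchySeq m := by
    have hdist : ∀ i j, dist (m i) (m j) ≤ ‖T‖ * dist (s i) (s j) := fun i j => by
      rw [dist_eq_norm, dist_eq_norm]
      exact norm_le_of_inner_eq (A := A) T fun u => by simp [hm]
    refine cauchySeq_iff_tendsto_dist_atTop_0.2 (squeeze_zero (fun _ => dist_nonneg)
      (fun p => hdist p.1 p.2) ?_)
    simpa using (cauchySeq_iff_tendsto_dist_atTop_0.1 hsz.cauchySeq).const_mul ‖T‖
  obtain ⟨l, hl⟩ := cauchySeq_tendsto_of_complete hcauchy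
  refine ⟨l, fun u => tendsto_nhds_unique ((innerSL (A := A) (T u)).continuous.tendsto z |>.comp hsz)
    (((innerSL (A := A) u).continuous.tendsto l |>.comp hl).congr fun n => ?_)⟩
  exact (hm n u).symm

/-- An increasing approximate unit of `A` acts approximately as the identity on a Hilbert
C⋆-module. -/
theorem tendsto_approximateUnit_op_smul (z : E) :
    Tendsto (fun a : A => a • z) (CStarAlgebra.approximateUnit A) (𝓝 z) := by
  have hl := CStarAlgebra.increasingApproximateUnit A
  have h1 := tendsto_iff_norm_sub_tendsto_zero.1 (hl.tendsto_mul_right ⟪z, z⟫_A)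
  rw [tendsto_iff_norm_sub_tendsto_zero]
  have h2 : Tendsto (fun a : A => ‖a • z - z‖ ^ 2) (CStarAlgebra.approximateUnit A) (𝓝 0) := by
    refine squeeze_zero' (Eventually.of_forall fun _ => by positivity) ?_
      (by simpa using h1.const_mul 2)
    filter_upwards [hl.eventually_norm] with a ha
    have key : ⟪a • z - z, a • z - z⟫_A
        = (a * ⟪z, z⟫_A - ⟪z, z⟫_A) * star a - (a * ⟪z, z⟫_A - ⟪z, z⟫_A) := by
      simp only [inner_sub_left, inner_sub_right, inner_op_smul_left, inner_op_smul_right, sub_mul,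
        mul_sub, mul_assoc]
      abel
    rw [norm_sq_eq A, key]
    calc _ ≤ ‖a * ⟪z, z⟫_A - ⟪z, z⟫_A‖ * ‖star a‖ + ‖a * ⟪z, z⟫_A - ⟪z, z⟫_A‖ :=
          (norm_sub_le _ _).trans (by gcongr; exact norm_mul_le _ _)
      _ ≤ ‖a * ⟪z, z⟫_A - ⟪z, z⟫_A‖ * 1 + ‖a * ⟪z, z⟫_A - ⟪z, z⟫_A‖ := by
          gcongr; rwa [norm_star]
      _ = 2 * ‖a * ⟪z, z⟫_A - ⟪z, z⟫_A‖ := by ring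
  simpa using h2.sqrt

theorem mem_adjointDomain_of_dense_op_smul [CompleteSpace E] {T : E →L[ℂ] F} {z : F} {s : Set A}
    (hs : (Submodule.span ℂ s).topologicalClosure = ⊤)
    (h : ∀ a ∈ s, a • z ∈ adjointDomain A T) : z ∈ adjointDomain A T := by
  let f : A →ₗ[ℂ] F :=
    { toFun := fun a => a • z
      map_add' := fun a b => add_op_smul a b z
      map_smul' := fun c a => smul_op_smul c a z }
  let g : A →L[ℂ] F := f.mkContinuous ‖z‖ fun a => by
    rw [mul_comm]; exact norm_op_smul_le a z
  have hle : (Submodule.span ℂ s).topologicalClosure ≤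
      (adjointDomain A T).comap (g : A →ₗ[ℂ] F) :=
    Submodule.topologicalClosure_minimal _ (Submodule.span_le.2 h)
      ((isClosed_adjointDomain T).preimage g.continuous)
  rw [hs] at hle
  exact (isClosed_adjointDomain T).mem_of_tendsto (tendsto_approximateUnit_op_smul (A := A) z)
    (Eventually.of_forall fun a => hle (Submodule.mem_top (x := a)))

/-- The range of an adjointable operator which is bounded below is orthogonally complemented. -/
theorem exists_orthogonal_sub_of_forall_mem_adjointDomain [CompleteSpace E] {T : E →L[ℂ] F}
    (hT : ∀ z, z ∈ adjointDomain A T) {c : ℝ} (hc : 0 < c) (hbelow : ∀ x, c * ‖x‖ ≤ ‖T x‖)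
    (z : F) : ∃ x, ∀ u, ⟪T u, z - T x⟫_A = 0 := by
  choose S hS using hT
  have hsymm : ∀ x y, ⟪S (T x), y⟫_A = ⟪x, S (T y)⟫_A := fun x y => by
    rw [← hS, inner_comm_congr (hS (T x) y).symm]
  have hbdd : ∀ x, ‖S (T x)‖ ≤ ‖T‖ * ‖T‖ * ‖x‖ := fun x =>
    (norm_le_of_inner_eq (A := A) T (hS (T x))).trans (by
      rw [mul_assoc]; gcongr; exact T.le_opNorm x)
  have hST : ∀ x, c ^ 2 * ‖x‖ ≤ ‖S (T x)‖ := fun x => by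
    rcases (norm_nonneg x).eq_or_lt with h0 | h0
    · rw [← h0, mul_zero]; positivity
    refine le_of_mul_le_mul_left ?_ h0
    calc ‖x‖ * (c ^ 2 * ‖x‖) = (c * ‖x‖) ^ 2 := by ring
      _ ≤ ‖T x‖ ^ 2 := by gcongr; exact hbelow x
      _ = ‖⟪x, S (T x)⟫_A‖ := by rw [norm_sq_eq A, hS]
      _ ≤ ‖x‖ * ‖S (T x)‖ := norm_inner_le E
  obtain ⟨x, hx⟩ := surjective_of_symmetric hsymm hbdd (by positivity) hST (S z)
  exact ⟨x, fun u => by rw [inner_sub_right, hS, hS, ← hx, sub_self]⟩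

/-- If the graph of `T` is orthogonally complemented then `T` is adjointable. -/
theorem mem_adjointDomain_of_graph [CompleteSpace E] {T : E →L[ℂ] F}
    (h₁ : ∀ y, ∃ x, ∀ u, ⟪u, y - x⟫_A = ⟪T u, T x⟫_A)
    (h₂ : ∀ z, ∃ x, ∀ u, ⟪T u, z - T x⟫_A = ⟪u, x⟫_A) (z : F) : z ∈ adjointDomain A T := by
  choose Q hQ using h₁
  have hQ' : ∀ u y, ⟪u, y⟫_A = ⟪u, Q y⟫_A + ⟪T u, T (Q y)⟫_A := fun u y => by
    rw [← hQ, inner_sub_right, add_sub_cancel]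
  have hsymm : ∀ x y, ⟪Q x, y⟫_A = ⟪x, Q y⟫_A := fun x y => by
    rw [hQ' (Q x) y, ← star_inner (Q y) x, hQ' (Q y) x, star_add, star_inner, star_inner]
  have hbdd : ∀ y, ‖Q y‖ ≤ 1 * ‖y‖ := fun y => by
    rcases (norm_nonneg (Q y)).eq_or_lt with h0 | h0
    · rw [← h0]; positivity
    refine le_of_mul_le_mul_left ?_ h0
    calc ‖Q y‖ * ‖Q y‖ = ‖⟪Q y, Q y⟫_A‖ := by rw [← norm_sq_eq A, sq]
      _ ≤ ‖⟪Q y, y⟫_A‖ := by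
          refine CStarAlgebra.norm_le_norm_of_nonneg_of_le inner_self_nonneg ?_
          rw [hQ' (Q y) y]
          exact le_add_of_nonneg_right inner_self_nonneg
      _ ≤ ‖Q y‖ * (1 * ‖y‖) := by rw [one_mul]; exact norm_inner_le E
  have hbelow : ∀ y, (1 + ‖T‖ * ‖T‖)⁻¹ * ‖y‖ ≤ ‖Q y‖ := fun y => by
    rw [inv_mul_le_iff₀ (by positivity)]
    have := norm_le_of_inner_eq (A := A) T fun u => (hQ y u).symm
    calc ‖y‖ = ‖Q y + (y - Q y)‖ := by rw [add_sub_cancel]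
      _ ≤ ‖Q y‖ + ‖T‖ * (‖T‖ * ‖Q y‖) := (norm_add_le _ _).trans (by
          gcongr; exact this.trans (by gcongr; exact T.le_opNorm _))
      _ = (1 + ‖T‖ * ‖T‖) * ‖Q y‖ := by ring
  have hrange : ∀ x, T x ∈ adjointDomain A T := fun x => by
    obtain ⟨y, rfl⟩ := surjective_of_symmetric hsymm hbdd (by positivity) hbelow x
    exact ⟨y - Q y, fun u => (hQ y u).symm⟩
  obtain ⟨x, hx⟩ := h₂ z
  have := add_mem (show z - T x ∈ adjointDomain A T from ⟨x, hx⟩) (hrange x)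
  rwa [sub_add_cancel] at this

end CStarModule

namespace HilbertCStarModule

open scoped InnerProductSpace WithCStarModule

/-- A Hilbert C⋆-module in Mathlib's convention, where the inner product is linear in the second
variable. -/
@[reducible]
def toCStarModule (A : Type*) [NonUnitalCStarAlgebra A] [PartialOrder A] [StarOrderedRing A]
    (M : Type*) [NormedAddCommGroup M] [NormedSpace ℂ M] [SMul A M] [HilbertCStarModule A M] :
    CStarModule A M where
  inner x y := hInner A y x
  inner_add_right := inner_add_left _ _ _
  inner_self_nonneg {x} := by
    obtain ⟨b, hb⟩ := inner_self_pos (A := A) x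
    change 0 ≤ HilbertCStarModule.inner x x
    rw [hb]
    exact star_mul_self_nonneg b
  inner_self := inner_self_eq_zero _
  inner_op_smul_right := inner_smulA_left _ _ _
  inner_smul_right_complex := inner_smulC_left _ _ _
  star_inner x y := (inner_conj x y).symm
  norm_eq_sqrt_norm_inner_self := norm_eq

/-- A complete Hilbert C⋆-module in Mathlib's convention is a Hilbert C⋆-module. -/
@[reducible]
def ofCStarModule (A : Type*) [NonUnitalCStarAlgebra A] [PartialOrder A] [StarOrderedRing A]
    (M : Type*) [NormedAddCommGroup M] [NormedSpace ℂ M] [SMul A M] [CStarModule A M]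
    [CompleteSpace M] : HilbertCStarModule A M where
  inner x y := ⟪y, x⟫_A
  smul_add' := CStarModule.op_smul_add
  add_smul' := CStarModule.add_op_smul
  mul_smul' := CStarModule.mul_op_smul
  smul_smul' := CStarModule.smul_op_smul
  inner_add_left _ _ _ := CStarModule.inner_add_right
  inner_smulA_left _ _ _ := CStarModule.inner_op_smul_right
  inner_smulC_left _ _ _ := CStarModule.inner_smul_right_complex
  inner_conj x y := (CStarModule.star_inner x y).symm
  inner_self_pos _ :=
    CStarAlgebra.nonneg_iff_eq_star_mul_self.1 CStarModule.inner_self_nonneg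
  inner_self_eq_zero _ := CStarModule.inner_self
  norm_eq := CStarModule.norm_eq_sqrt_norm_inner_self
  complete := inferInstance

end HilbertCStarModule

namespace IsBoundedModuleMap

variable {A M N : Type*} [NonUnitalCStarAlgebra A]
  [NormedAddCommGroup M] [NormedSpace ℂ M] [SMul A M]
  [NormedAddCommGroup N] [NormedSpace ℂ N] [SMul A N]

/-- The continuous linear map underlying a bounded module map. -/
def toContinuousLinearMap {T : M → N} (hT : IsBoundedModuleMap A T) : M →L[ℂ] N :=
  LinearMap.mkContinuousOfExistsBound
    { toFun := T, map_add' := hT.map_add, map_smul' := hT.map_smulC } hT.bound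

end IsBoundedModuleMap

open scoped InnerProductSpace WithCStarModule

/-- STATEMENT 19: A full Hilbert `A`-module has the property that every bounded `A`-linear
operator on it is adjointable if and only if it is orthogonally complementary. -/
theorem adjointable_iff_orthogonally_complementary
    (A : Type u) [NonUnitalCStarAlgebra A]
    (M : Type v) [NormedAddCommGroup M] [NormedSpace ℂ M] [SMul A M] [HilbertCStarModule A M]
    (hfull : (Submodule.span ℂ {a : A | ∃ x y : M, a = hInner A x y}).topologicalClosure = ⊤) :
    (∀ T : M → M, IsBoundedModuleMap A T →
      ∃ S : M → M, IsBoundedModuleMap A S ∧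
        ∀ x y : M, hInner A (T x) y = hInner A x (S y)) ↔
    (∀ (L : Type v) [NormedAddCommGroup L] [NormedSpace ℂ L] [SMul A L]
        [HilbertCStarModule A L] (ι : M → L),
      IsBoundedModuleMap A ι → Function.Injective ι → IsClosed (Set.range ι) →
      (∃ c : ℝ, 0 < c ∧ ∀ x : M, c * ‖x‖ ≤ ‖ι x‖) →
      ∀ z : L, ∃ (x : M) (w : L), w ∈ orthComp A (Set.range ι) ∧ z = ι x + w) := by
  let _ := CStarAlgebra.spectralOrder A
  have _ := CStarAlgebra.spectralOrderedRing A
  let _ := HilbertCStarModule.toCStarModule A M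
  have _ : CompleteSpace M := HilbertCStarModule.complete A
  constructor
  · intro hadj L _ _ _ _ ι hι _ _ hbelow z
    let _ := HilbertCStarModule.toCStarModule A L
    obtain ⟨c, hc, hbelow⟩ := hbelow
    let T : M →L[ℂ] L := hι.toContinuousLinearMap
    have hT : ∀ z, z ∈ CStarModule.adjointDomain A T := fun z => by
      refine CStarModule.mem_adjointDomain_of_dense_op_smul hfull ?_
      rintro _ ⟨w, y, rfl⟩
      obtain ⟨S, -, hS⟩ := hadj (fun u => ⟪z, T u⟫_A • y)
        { map_add := fun u v => by simp [CStarModule.add_op_smul]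
          map_smulC := fun k u => by simp [CStarModule.smul_op_smul]
          map_smulA := fun a u => by
            rw [← CStarModule.mul_op_smul, ← CStarModule.inner_op_smul_right]
            exact congrArg (fun v => ⟪z, v⟫_A • y) (hι.map_smulA a u)
          bound := ⟨‖z‖ * ‖T‖ * ‖y‖, fun u =>
            calc _ ≤ ‖⟪z, T u⟫_A‖ * ‖y‖ := CStarModule.norm_op_smul_le _ _
              _ ≤ (‖z‖ * (‖T‖ * ‖u‖)) * ‖y‖ := by
                gcongr
                exact (CStarModule.norm_inner_le L).trans (by gcongr; exact T.le_opNorm u)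
              _ = ‖z‖ * ‖T‖ * ‖y‖ * ‖u‖ := by ring⟩ }
      refine ⟨S w, fun u => CStarModule.inner_comm_congr ?_⟩
      rw [CStarModule.inner_op_smul_left]
      refine Eq.trans ?_ (hS u w)
      change _ = ⟪w, ⟪z, T u⟫_A • y⟫_A
      rw [CStarModule.inner_op_smul_right]
      change _ * star ⟪y, w⟫_A = _
      rw [CStarModule.star_inner]
    obtain ⟨x, hx⟩ := CStarModule.exists_orthogonal_sub_of_forall_mem_adjointDomain hT hc hbelow z
    refine ⟨x, z - ι x, ?_, (add_sub_cancel _ _).symm⟩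
    rintro _ ⟨u, rfl⟩
    exact hx u
  · intro hcompl T hT
    let T' : M →L[ℂ] M := hT.toContinuousLinearMap
    let _ := HilbertCStarModule.ofCStarModule A C⋆ᵐᵒᵈ(A, M × M)
    let ι : M → C⋆ᵐᵒᵈ(A, M × M) := fun x => (WithCStarModule.equiv A (M × M)).symm (x, T x)
    have hlow : ∀ x, ‖x‖ ≤ ‖ι x‖ := fun x =>
      (le_max_left _ _).trans (WithCStarModule.max_le_prod_norm (ι x))
    have hι : IsBoundedModuleMap A ι :=
      { map_add := fun x y => by simp only [ι, hT.map_add]; rfl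
        map_smulC := fun c x => by simp only [ι, hT.map_smulC]; rfl
        map_smulA := fun a x => by simp only [ι, hT.map_smulA]; rfl
        bound := ⟨1 + ‖T'‖, fun x => by
          refine (WithCStarModule.prod_norm_le_norm_add (ι x)).trans ?_
          rw [add_mul, one_mul]
          exact add_le_add le_rfl (T'.le_opNorm x)⟩ }
    have hanti : AntilipschitzWith 1 hι.toContinuousLinearMap :=
      AddMonoidHomClass.antilipschitz_of_bound _ fun x => by
        rw [NNReal.coe_one, one_mul]; exact hlow x
    have hgraph := hcompl C⋆ᵐᵒᵈ(A, M × M) ι hι hanti.injective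
      (hanti.isClosed_range hι.toContinuousLinearMap.uniformContinuous)
      ⟨1, one_pos, fun x => by simpa using hlow x⟩
    have hgraph' : ∀ y z : M, ∃ x, ∀ u, ⟪u, y - x⟫_A + ⟪T' u, z - T' x⟫_A = 0 := fun y z => by
      obtain ⟨x, w, hw, hz⟩ := hgraph ((WithCStarModule.equiv A (M × M)).symm (y, z))
      refine ⟨x, fun u => ?_⟩
      have hwu : ⟪ι u, w⟫_A = 0 := hw _ ⟨u, rfl⟩
      rw [eq_sub_of_add_eq' hz.symm] at hwu
      exact hwu
    have hdom := CStarModule.mem_adjointDomain_of_graph (A := A) (T := T')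
      (fun y => (hgraph' y 0).imp fun x hx u => by
        simpa [← sub_eq_add_neg, sub_eq_zero] using hx u)
      (fun z => (hgraph' 0 z).imp fun x hx u => by
        have h := hx u
        rw [zero_sub, CStarModule.inner_neg_right, neg_add_eq_zero] at h
        exact h.symm)
    choose S hS using hdom
    refine ⟨S, ⟨fun x y => ?_, fun c x => ?_, fun a x => ?_, ‖T'‖, fun x => ?_⟩, fun x y => ?_⟩
    · exact CStarModule.ext_inner A fun u => by simp [← hS]
    · exact CStarModule.ext_inner A fun u => by simp [← hS]
    · exact CStarModule.ext_inner A fun u => by simp [← hS]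
    · exact CStarModule.norm_le_of_inner_eq (A := A) T' (hS x)
    · exact CStarModule.inner_comm_congr (hS y x)
end
end
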